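/- Let P = P_{n,r} be the poset of r-colored injective words with the natural 𝔖_n-action, let S = {s_1 < ⋯ < s_k} ⊆ {1,…,n−1} and let λ be a partition of n. Then the multiplicity of ρ^λ in β_P(S) equals (−1)^k δ_{λ,(n)} + Σ_{i=1}^k (−1)^{k−i} b_{s_i}({s_1,…,s_{i−1}}) · r^{s_i} · f^{λ,n−s_i}, where δ_{λ,(n)} is a Kronecker delta, b_m(T) is the number of permutations in 𝔖_m with descent set T, and f^{λ,n−s_i} is the number of standard Young tableaux of shape λ whose first row contains the numbers 1,2,…,n−s_i. -/

import Mathlib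

open scoped Classical

noncomputable section

/-! ### Permutation combinatorics -/

/-- The value `w(i)` (1-based, in `{1,…,n}`) of a permutation `w` of `{1,…,n}`,
realized as `Equiv.Perm (Fin n)`. -/
def permApp {n : ℕ} (w : Equiv.Perm (Fin n)) (i : ℕ) : ℕ :=
  if h : i - 1 < n then (w ⟨i - 1, h⟩ : ℕ) + 1 else 0

/-- The descent set of a permutation, a subset of `{1,…,n-1}`. -/
def descentSet {n : ℕ} (w : Equiv.Perm (Fin n)) : Finset ℕ :=
  (Finset.Icc 1 (n - 1)).filter fun i => permApp w (i + 1) < permApp w i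

/-- `numDescentSet m T` is the number of permutations in `𝔖_m` with descent set `T`. -/
def numDescentSet (m : ℕ) (T : Finset ℕ) : ℕ :=
  Nat.card {w : Equiv.Perm (Fin m) // descentSet w = T}

/-- The Coxeter length (number of inversions) of a permutation. -/
def invCount {n : ℕ} (w : Equiv.Perm (Fin n)) : ℕ :=
  (Finset.univ.filter fun p : Fin n × Fin n => p.1 < p.2 ∧ w p.2 < w p.1).card

/-- For `S = {s_1 < s_2 < ⋯ < s_k} ⊆ {1,…,n-1}`, `sElt n S j = s_j`, with the
conventions `s_0 = 0` and `s_j = n` for `j > k`. -/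
def sElt (n : ℕ) (S : Finset ℕ) (j : ℕ) : ℕ :=
  if j = 0 then 0 else if j ≤ S.card then (S.sort (· ≤ ·)).getD (j - 1) 0 else n

lemma sElt_of_gt (n : ℕ) (S : Finset ℕ) (j : ℕ) (h : S.card < j) : sElt n S j = n := by
  unfold sElt
  rw [if_neg (by omega), if_neg (by omega)]

/-! ### Standard Young tableaux -/

/-- A standard Young tableau of shape `μ`: a filling of the cells of `μ` by the numbers
`1,…,μ.card`, each used once, strictly increasing along rows and columns
(the entry of a non-cell is `0`). -/
structure SYT (μ : YoungDiagram) where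
  entry : ℕ → ℕ → ℕ
  entry_eq_zero : ∀ i j, (i, j) ∉ μ → entry i j = 0
  row_strict : ∀ i j1 j2, j1 < j2 → (i, j2) ∈ μ → entry i j1 < entry i j2
  col_strict : ∀ i1 i2 j, i1 < i2 → (i2, j) ∈ μ → entry i1 j < entry i2 j
  bijOn : Set.BijOn (fun p : ℕ × ℕ => entry p.1 p.2) ↑μ.cells ↑(Finset.Icc 1 μ.card)

/-- The descent set of a standard Young tableau: those `k` such that `k+1` lies in a
strictly lower row than `k`. -/
def SYT.des {μ : YoungDiagram} (Q : SYT μ) : Finset ℕ :=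
  (Finset.Icc 1 (μ.card - 1)).filter fun k =>
    ∃ p1 ∈ μ.cells, ∃ p2 ∈ μ.cells,
      Q.entry p1.1 p1.2 = k ∧ Q.entry p2.1 p2.2 = k + 1 ∧ p1.1 < p2.1

/-- `fSYTRow μ t` is the number of standard Young tableaux of shape `μ` whose first row
contains the numbers `1,…,t`. -/
def fSYTRow (μ : YoungDiagram) (t : ℕ) : ℕ :=
  Nat.card {Q : SYT μ // ∀ k, 1 ≤ k → k ≤ t → ∃ j, (0, j) ∈ μ ∧ Q.entry 0 j = k}

/-! ### Irreducible characters of the symmetric group, via Jacobi–Trudi -/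

/-- The number of functions `f : Fin n → Fin k` which are invariant under `g` and whose
fiber over `i` has `c i` elements.  For `c` a composition of `n`, the function
`g ↦ fixedYoungFns n k c g` is the character of the permutation representation of `𝔖_n`
on ordered set partitions of `{1,…,n}` of type `c`, i.e. of the representation induced
from the trivial representation of the corresponding Young subgroup. -/
def fixedYoungFns (n k : ℕ) (c : Fin k → ℤ) (g : Equiv.Perm (Fin n)) : ℕ :=
  Nat.card {f : Fin n → Fin k //
    (∀ x, f (g x) = f x) ∧ ∀ i, ((Nat.card {x : Fin n // f x = i} : ℕ) : ℤ) = c i}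

/-- The irreducible character `χ^μ` of `𝔖_n` associated to a partition `μ` of `n`
(encoded as a Young diagram with `n` cells), defined through the Jacobi–Trudi
determinantal formula `χ^μ = det (h_{μ_i - i + j})`. -/
def chi (n : ℕ) (μ : YoungDiagram) (g : Equiv.Perm (Fin n)) : ℤ :=
  ∑ σ : Equiv.Perm (Fin μ.rowLens.length),
    ((Equiv.Perm.sign σ : ℤˣ) : ℤ) *
      (fixedYoungFns n μ.rowLens.length
        (fun i => ((μ.rowLen (i : ℕ) : ℕ) : ℤ) - ((i : ℕ) : ℤ) + ((σ i : ℕ) : ℤ)) g : ℤ)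

/-! ### Posets, rank selection, maximal chains and characters -/

/-- The maximal chains of the subposet induced on a subset `A` of a poset. -/
def maxChainsIn {P : Type*} [Preorder P] (A : Set P) : Set (Set P) :=
  {C | C ⊆ A ∧ IsChain (· ≤ ·) C ∧
    ∀ D : Set P, D ⊆ A → IsChain (· ≤ ·) D → C ⊆ D → C = D}

/-- The rank-selected subposet `P_S = {x ∈ P : rk x ∈ S} ∪ {⊥, ⊤}`. -/
def rankSel {P : Type*} [Preorder P] [OrderBot P] [OrderTop P] (rk : P → ℕ)
    (S : Finset ℕ) : Set P :=
  {x | rk x ∈ S} ∪ {⊥, ⊤}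

/-- `a_P(S)`: the number of maximal chains of the rank-selected subposet `P_S`. -/
def chainCount {P : Type*} [Preorder P] [OrderBot P] [OrderTop P] (rk : P → ℕ)
    (S : Finset ℕ) : ℕ :=
  Set.ncard (maxChainsIn (rankSel rk S))

/-- `b_P(S) = Σ_{T ⊆ S} (-1)^{|S-T|} a_P(T)`. -/
def bDim {P : Type*} [Preorder P] [OrderBot P] [OrderTop P] (rk : P → ℕ)
    (S : Finset ℕ) : ℤ :=
  ∑ T ∈ S.powerset, (-1 : ℤ) ^ (S.card - T.card) * (chainCount rk T : ℤ)

/-- The character of the permutation representation `α_P(S)` of a group `G` acting (via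
`act`) on the maximal chains of the rank-selected subposet `P_S`: its value at `g` is
the number of maximal chains of `P_S` fixed by `g`. -/
def gAlpha {P G : Type*} [Preorder P] [OrderBot P] [OrderTop P] (rk : P → ℕ)
    (act : G → P → P) (S : Finset ℕ) (g : G) : ℤ :=
  (Set.ncard {C : Set P | C ∈ maxChainsIn (rankSel rk S) ∧ act g '' C = C} : ℤ)

/-- The character of the virtual representation
`β_P(S) = Σ_{T ⊆ S} (-1)^{|S-T|} α_P(T)`. -/
def gBeta {P G : Type*} [Preorder P] [OrderBot P] [OrderTop P] (rk : P → ℕ)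
    (act : G → P → P) (S : Finset ℕ) (g : G) : ℤ :=
  ∑ T ∈ S.powerset, (-1 : ℤ) ^ (S.card - T.card) * gAlpha rk act T g

/-! ### The poset of injective words -/

/-- An injective word over the alphabet `{1,…,n}`. -/
def InjWord (n : ℕ) : Type := {l : List (Fin n) // l.Nodup}

instance (n : ℕ) : PartialOrder (InjWord n) where
  le u v := u.1.Sublist v.1
  le_refl u := List.Sublist.refl _
  le_trans u v w h1 h2 := List.Sublist.trans h1 h2
  le_antisymm u v h1 h2 := Subtype.ext (List.Sublist.antisymm h1 h2)

instance (n : ℕ) : OrderBot (InjWord n) where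
  bot := ⟨[], List.nodup_nil⟩
  bot_le u := List.nil_sublist u.1

/-- The rank function of the poset of injective words (with a maximum adjoined):
the rank of a word is its length, and the rank of `⊤` is `n+1`. -/
def rkInj (n : ℕ) (x : WithTop (InjWord n)) : ℕ :=
  WithTop.recTopCoe (n + 1) (fun u => u.1.length) x

/-- The action of `𝔖_n` on injective words, letter by letter. -/
def permWord {n : ℕ} (w : Equiv.Perm (Fin n)) (u : InjWord n) : InjWord n :=
  ⟨u.1.map w, u.2.map w.injective⟩

/-- The character of `α_{P_n}(S)` for the `𝔖_n`-action on the poset of injective words. -/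
def injAlpha (n : ℕ) (S : Finset ℕ) (g : Equiv.Perm (Fin n)) : ℤ :=
  gAlpha (rkInj n) (fun w : Equiv.Perm (Fin n) => WithTop.map (permWord w)) S g

/-- The character of `β_{P_n}(S)` for the `𝔖_n`-action on the poset of injective words. -/
def injBeta (n : ℕ) (S : Finset ℕ) (g : Equiv.Perm (Fin n)) : ℤ :=
  gBeta (rkInj n) (fun w : Equiv.Perm (Fin n) => WithTop.map (permWord w)) S g

/-! ### The poset of r-colored injective words -/

/-- An `r`-colored injective word over `{1,…,n}`: a word in the alphabet
`{1,…,n} × ℤ_r` whose letters have pairwise distinct first coordinates. -/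
def CInjWord (n r : ℕ) : Type := {l : List (Fin n × ZMod r) // (l.map Prod.fst).Nodup}

instance (n r : ℕ) : PartialOrder (CInjWord n r) where
  le u v := u.1.Sublist v.1
  le_refl u := List.Sublist.refl _
  le_trans u v w h1 h2 := List.Sublist.trans h1 h2
  le_antisymm u v h1 h2 := Subtype.ext (List.Sublist.antisymm h1 h2)

instance (n r : ℕ) : OrderBot (CInjWord n r) where
  bot := ⟨[], by simp⟩
  bot_le u := List.nil_sublist u.1

/-- The rank function of the poset `P_{n,r}` of `r`-colored injective words
(with a maximum adjoined). -/
def rkC (n r : ℕ) (x : WithTop (CInjWord n r)) : ℕ :=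
  WithTop.recTopCoe (n + 1) (fun u => u.1.length) x

/-- The action of `𝔖_n` on `r`-colored injective words: act on the first coordinate
of each letter, leaving colors unchanged. -/
def permCWord {n r : ℕ} (w : Equiv.Perm (Fin n)) (u : CInjWord n r) : CInjWord n r :=
  ⟨u.1.map (fun p => (w p.1, p.2)), by
    have h := u.2.map w.injective
    rw [List.map_map] at h ⊢
    exact h⟩

/-- The character of `α_{P_{n,r}}(S)`. -/
def cAlpha (n r : ℕ) (S : Finset ℕ) (g : Equiv.Perm (Fin n)) : ℤ :=
  gAlpha (rkC n r) (fun w : Equiv.Perm (Fin n) => WithTop.map (permCWord w)) S g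

/-- The character of `β_{P_{n,r}}(S)`. -/
def cBeta (n r : ℕ) (S : Finset ℕ) (g : Equiv.Perm (Fin n)) : ℤ :=
  gBeta (rkC n r) (fun w : Equiv.Perm (Fin n) => WithTop.map (permCWord w)) S g

/-- `b_{P_{n,r}}(S)`, the dimension of `β_{P_{n,r}}(S)`. -/
def cChainDim (n r : ℕ) (S : Finset ℕ) : ℤ := bDim (rkC n r) S

/-! ### The statistics τ -/

/-- `τ(w,Q)` for a permutation `w` with descent set `S = {s_1 < ⋯ < s_k}` and a standard
Young tableau `Q`: the largest `i ∈ {0,…,k+1}` such that (a) `w(x) = w_S(x)` for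
`x > s_{k+1-i}` and (b) no descent of `Q` is smaller than `n - s_{k+1-i}`. -/
def tau (n : ℕ) (S : Finset ℕ) (wS w : Equiv.Perm (Fin n)) {μ : YoungDiagram}
    (Q : SYT μ) : ℕ :=
  ((Finset.range (S.card + 2)).filter
    (fun i => (∀ x, sElt n S (S.card + 1 - i) < x → x ≤ n → permApp w x = permApp wS x) ∧
      (∀ d ∈ Q.des, n - sElt n S (S.card + 1 - i) ≤ d))).max'
    ⟨0, by
      have hs := sElt_of_gt n S (S.card + 1 - 0) (by omega)
      refine Finset.mem_filter.2 ⟨Finset.mem_range.2 (by omega), ?_, ?_⟩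
      · intro x hx hx'
        rw [hs] at hx
        exact absurd hx (not_lt.2 hx')
      · intro d _
        rw [hs]
        omega⟩

/-- The condition that all the numbers `1,…,t` appear in the first row of the `r`-colored
standard Young tableau `(Q, c)` and are colored with the zero color (the color of the
entry `k` being `c (k-1)`). -/
def zeroFirstRow {μ : YoungDiagram} {r : ℕ} (Q : SYT μ) (c : Fin μ.card → ZMod r)
    (t : ℕ) : Prop :=
  ∀ k : Fin μ.card, (k : ℕ) < t →
    ((∃ j, (0, j) ∈ μ ∧ Q.entry 0 j = (k : ℕ) + 1) ∧ c k = 0)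

/-- `τ(w,Q)` for an `r`-colored standard Young tableau `(Q,c)`. -/
def ctau (n : ℕ) {r : ℕ} (S : Finset ℕ) (wS w : Equiv.Perm (Fin n)) {μ : YoungDiagram}
    (Q : SYT μ) (c : Fin μ.card → ZMod r) : ℕ :=
  ((Finset.range (S.card + 2)).filter
    (fun i => (∀ x, sElt n S (S.card + 1 - i) < x → x ≤ n → permApp w x = permApp wS x) ∧
      zeroFirstRow Q c (n - sElt n S (S.card + 1 - i)))).max'
    ⟨0, by
      have hs := sElt_of_gt n S (S.card + 1 - 0) (by omega)
      refine Finset.mem_filter.2 ⟨Finset.mem_range.2 (by omega), ?_, ?_⟩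
      · intro x hx hx'
        rw [hs] at hx
        exact absurd hx (not_lt.2 hx')
      · rw [hs]
        intro k hk
        exact absurd hk (by omega)⟩

/-- The largest `i ∈ {0,…,n}` such that all the numbers `1,…,i` appear in the first row
of the `r`-colored standard Young tableau `(Q,c)` and are colored with the zero color. -/
def mQ (n : ℕ) {r : ℕ} {μ : YoungDiagram} (Q : SYT μ) (c : Fin μ.card → ZMod r) : ℕ :=
  ((Finset.range (n + 1)).filter (fun i => zeroFirstRow Q c i)).max'
    ⟨0, Finset.mem_filter.2 ⟨Finset.mem_range.2 (by omega),
      fun k hk => absurd hk (by omega)⟩⟩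

/-- The condition, for an `r`-colored permutation `(π, c)` (the color of the entry
`π(x)` in one-line notation being `c (x-1)`), that the entries `π(1),…,π(t)` are in
increasing order and all colored with the zero color. -/
def zeroIncreasing {n r : ℕ} (π : Equiv.Perm (Fin n)) (c : Fin n → ZMod r) (t : ℕ) : Prop :=
  (∀ x y, 1 ≤ x → x < y → y ≤ t → permApp π x < permApp π y) ∧
  ∀ k : Fin n, (k : ℕ) < t → c k = 0

/-- `τ(w,u)` for an `r`-colored permutation `u = (π, c)`. -/
def tauU (n : ℕ) {r : ℕ} (S : Finset ℕ) (wS w : Equiv.Perm (Fin n))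
    (π : Equiv.Perm (Fin n)) (c : Fin n → ZMod r) : ℕ :=
  ((Finset.range (S.card + 2)).filter
    (fun i => (∀ x, sElt n S (S.card + 1 - i) < x → x ≤ n → permApp w x = permApp wS x) ∧
      zeroIncreasing π c (n - sElt n S (S.card + 1 - i)))).max'
    ⟨0, by
      have hs := sElt_of_gt n S (S.card + 1 - 0) (by omega)
      refine Finset.mem_filter.2 ⟨Finset.mem_range.2 (by omega), ?_, ?_, ?_⟩
      · intro x hx hx'
        rw [hs] at hx
        exact absurd hx (not_lt.2 hx')
      · intro x y hx hxy hy
        rw [hs] at hy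
        exact absurd hy (by omega)
      · rw [hs]
        intro k hk
        exact absurd hk (by omega)⟩

/-- The largest `i ∈ {0,…,n}` such that the entries `π(1),…,π(i)` of the `r`-colored
permutation `(π,c)` are in increasing order and all colored with the zero color. -/
def mU (n : ℕ) {r : ℕ} (π : Equiv.Perm (Fin n)) (c : Fin n → ZMod r) : ℕ :=
  ((Finset.range (n + 1)).filter (fun i => zeroIncreasing π c i)).max'
    ⟨0, Finset.mem_filter.2 ⟨Finset.mem_range.2 (by omega),
      fun x y hx hxy hy => absurd hy (by omega),
      fun k hk => absurd hk (by omega)⟩⟩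

/-- `a_m(T)`: the number of chains in the Boolean lattice `B_m` whose elements have
set of ranks (cardinalities) equal to `T`. -/
def boolChains (m : ℕ) (T : Finset ℕ) : ℕ :=
  Nat.card {c : Finset (Finset (Fin m)) //
    IsChain (· ⊆ ·) (↑c : Set (Finset (Fin m))) ∧ c.image Finset.card = T}

end


/-! ### Part A: permutations with prescribed descents and chains of subsets -/

lemma A_mem_descentSet {m : ℕ} (w : Equiv.Perm (Fin m)) (i : ℕ) :
    i ∈ descentSet w ↔ ∃ (h1 : 1 ≤ i) (h : i < m), w ⟨i, h⟩ < w ⟨i - 1, by omega⟩ := by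
  unfold descentSet permApp
  simp only [Finset.mem_filter, Finset.mem_Icc]
  constructor
  · rintro ⟨⟨h1, h2⟩, h3⟩
    have hi : i < m := by omega
    refine ⟨h1, hi, ?_⟩
    rw [dif_pos (show i + 1 - 1 < m by omega), dif_pos (show i - 1 < m by omega)] at h3
    simp only [Nat.add_sub_cancel] at h3
    exact Fin.lt_def.2 (by omega)
  · rintro ⟨h1, hi, h⟩
    refine ⟨⟨h1, by omega⟩, ?_⟩
    rw [dif_pos (show i + 1 - 1 < m by omega), dif_pos (show i - 1 < m by omega)]
    simp only [Nat.add_sub_cancel]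
    have := Fin.lt_def.1 h
    omega

/-- initial segment -/
def iniSeg (m s : ℕ) : Finset (Fin m) := Finset.univ.filter fun i => (i : ℕ) < s

lemma iniSeg_card {m s : ℕ} (h : s ≤ m) : (iniSeg m s).card = s := by
  unfold iniSeg
  rw [Fin.card_filter_val_lt]
  omega

/-- number of perms with descents in `T` -/
noncomputable def descSub (m : ℕ) (T : Finset ℕ) : ℕ :=
  Nat.card {w : Equiv.Perm (Fin m) // descentSet w ⊆ T}

lemma lt_of_no_desc {m : ℕ} (w : Equiv.Perm (Fin m)) (i j : Fin m) (hij : i < j)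
    (h : ∀ s, (i : ℕ) < s → s ≤ (j : ℕ) → s ∉ descentSet w) : w i < w j := by
  obtain ⟨i, hi⟩ := i
  obtain ⟨j, hj⟩ := j
  simp only [Fin.mk_lt_mk] at hij
  simp only at h
  induction j with
  | zero => omega
  | succ j ih =>
    have h1 : w ⟨j, by omega⟩ < w ⟨j + 1, hj⟩ := by
      have := h (j + 1) (by omega) le_rfl
      rw [A_mem_descentSet] at this
      push Not at this
      have h2 := this (by omega) hj
      simp only [Nat.add_sub_cancel] at h2
      refine lt_of_le_of_ne h2 ?_
      intro he
      have := w.injective he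
      simp at this
    rcases Nat.lt_or_ge i j with hh | hh
    · exact (ih (by omega) (fun s hs hs' => h s hs (by omega)) hh).trans h1
    · have : i = j := by omega
      subst this
      exact h1

lemma eq_sort_of_chain {m : ℕ} (T : Finset ℕ) (x : T → Finset (Fin m)) (w : Equiv.Perm (Fin m))
    (hw : descentSet w ⊆ T) (hx : ∀ s : T, (iniSeg m s).map w.toEmbedding = x s) :
    w = Tuple.sort (fun p => (Finset.univ.filter fun s : T => p ∉ x s).card) := by
  rw [Tuple.eq_sort_iff]
  have key : ∀ i (s : T), w i ∉ x s ↔ (s : ℕ) ≤ i := by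
    intro i s
    rw [← hx s]
    simp [iniSeg]
  refine ⟨?_, ?_⟩
  · intro i j hij
    simp only [Function.comp, key]
    apply Finset.card_le_card
    intro s
    simp only [Finset.mem_filter, Finset.mem_univ, true_and]
    have : (i : ℕ) ≤ j := hij
    omega
  · intro i j hij he
    simp only [key] at he
    apply lt_of_no_desc w i j hij
    intro s h1 h2 hs
    have : (Finset.univ.filter fun s : T => (s : ℕ) ≤ i) ⊂ (Finset.univ.filter fun s : T => (s : ℕ) ≤ j) := by
      rw [Finset.ssubset_iff_of_subset]
      · refine ⟨⟨s, hw hs⟩, ?_, ?_⟩ <;> simp <;> omega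
      · intro s
        simp only [Finset.mem_filter, Finset.mem_univ, true_and]
        have : (i : ℕ) < j := hij
        omega
    have := Finset.card_lt_card this
    omega

lemma lower_eq_iniSeg {m : ℕ} (A : Finset (Fin m)) (h : ∀ i j, i ≤ j → j ∈ A → i ∈ A) :
    A = iniSeg m A.card := by
  have hc : A.card ≤ m := by simpa using Finset.card_le_univ A
  by_contra hne
  -- either A ⊆ ini or ini ⊆ A
  have : A ⊆ iniSeg m A.card ∨ iniSeg m A.card ⊆ A := by
    by_contra hh
    push Not at hh
    obtain ⟨h1, h2⟩ := hh
    obtain ⟨a, ha, ha'⟩ := Finset.not_subset.1 h1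
    obtain ⟨b, hb, hb'⟩ := Finset.not_subset.1 h2
    apply hb'
    apply h b a _ ha
    simp [iniSeg] at ha' hb
    exact Fin.le_def.2 (by omega)
  rcases this with h1 | h1
  · exact hne (Finset.eq_of_subset_of_card_le h1 (by rw [iniSeg_card hc]))
  · exact hne (Finset.eq_of_subset_of_card_le h1 (by rw [iniSeg_card hc])).symm

lemma exists_perm_of_chain {m : ℕ} (T : Finset ℕ) (x : T → Finset (Fin m))
    (hm : Monotone x) (hc : ∀ s, (x s).card = s) :
    ∃ w : Equiv.Perm (Fin m), descentSet w ⊆ T ∧ ∀ s : T, (iniSeg m s).map w.toEmbedding = x s := by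
  set h : Fin m → ℕ := fun p => (Finset.univ.filter fun s : T => p ∉ x s).card with hh
  obtain ⟨h1, h2⟩ := (Tuple.eq_sort_iff (f := h)).1 rfl
  set w := Tuple.sort h
  have hx : ∀ s : T, ∀ p q, h p ≤ h q → q ∈ x s → p ∈ x s := by
    intro s p q hpq hq
    by_contra hp
    have : (Finset.univ.filter fun s : T => q ∉ x s) ⊂ (Finset.univ.filter fun s : T => p ∉ x s) := by
      rw [Finset.ssubset_iff_of_subset]
      · exact ⟨s, by simpa using hp, by simpa using hq⟩
      · intro a
        simp only [Finset.mem_filter, Finset.mem_univ, true_and]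
        intro ha
        rcases le_total a s with h3 | h3
        · exact fun hpa => hp (hm h3 hpa)
        · exact absurd (hm h3 hq) ha
    have := Finset.card_lt_card this
    simp only [hh] at hpq
    omega
  have hini : ∀ s : T, (iniSeg m s).map w.toEmbedding = x s := by
    intro s
    have e := lower_eq_iniSeg ((x s).map w.symm.toEmbedding) (by
      intro i j hij hj
      simp only [Finset.mem_map_equiv, Equiv.symm_symm] at hj ⊢
      exact hx s _ _ (h1 hij) hj)
    rw [Finset.card_map, hc] at e
    rw [← e]
    ext p
    simp
  refine ⟨w, ?_, hini⟩
  intro i hi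
  rw [A_mem_descentSet] at hi
  obtain ⟨hi1, hi2, hlt⟩ := hi
  have hne : h (w ⟨i - 1, by omega⟩) ≠ h (w ⟨i, hi2⟩) := by
    intro he
    exact absurd (h2 ⟨i - 1, by omega⟩ ⟨i, hi2⟩ (Fin.lt_def.2 (by simp; omega)) he) (by simpa using hlt.le)
  by_contra hiT
  apply hne
  simp only [hh]
  congr 1
  ext s
  simp only [Finset.mem_filter, Finset.mem_univ, true_and]
  rw [← hini s]
  have : (s : ℕ) ≠ i := fun he => hiT (he ▸ s.2)
  simp [iniSeg]
  omega

/-- chains of subsets are counted by permutations -/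
lemma card_chain_subsets (m : ℕ) (T : Finset ℕ) (hT : ∀ s ∈ T, s ≤ m) :
    Nat.card {x : T → Finset (Fin m) // Monotone x ∧ ∀ s, (x s).card = s} = descSub m T := by
  unfold descSub
  symm
  apply Nat.card_congr
  refine Equiv.ofBijective (fun w => ⟨fun s => (iniSeg m s).map w.1.toEmbedding, ?_, ?_⟩) ⟨?_, ?_⟩
  · intro a b hab
    apply Finset.map_subset_map.2
    intro i
    have : (a : ℕ) ≤ b := hab
    simp [iniSeg]
    omega
  · intro s
    rw [Finset.card_map, iniSeg_card (hT s s.2)]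
  · intro w w' hww
    have h := congrArg Subtype.val hww
    simp only at h
    apply Subtype.ext
    exact (eq_sort_of_chain T _ w.1 w.2 (fun s => congrFun h s)).trans
      (eq_sort_of_chain T _ w'.1 w'.2 (fun _ => rfl)).symm
  · rintro ⟨x, h1, h2⟩
    obtain ⟨w, hw, hx⟩ := exists_perm_of_chain T x h1 h2
    exact ⟨⟨w, hw⟩, Subtype.ext (funext hx)⟩


/-! ### Part B: inclusion-exclusion -/

lemma B_alt (U : Finset ℕ) : ∀ D : Finset ℕ,
    (∑ T ∈ U.powerset, (-1 : ℤ) ^ (U.card - T.card) * (if D ⊆ T then 1 else 0)) =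
      if D = U then 1 else 0 := by
  induction U using Finset.induction_on with
  | empty => 
    intro D
    rw [Finset.powerset_empty, Finset.sum_singleton]
    simp only [Finset.subset_empty]
    simp
  | insert a U ha ih =>
    intro D
    rw [Finset.sum_powerset_insert ha]
    have hc : ∀ T ∈ U.powerset, (insert a T).card = T.card + 1 ∧ T.card ≤ U.card ∧ a ∉ T := by
      intro T hT
      rw [Finset.mem_powerset] at hT
      have : a ∉ T := fun h => ha (hT h)
      exact ⟨Finset.card_insert_of_notMem this, Finset.card_le_card hT, this⟩
    rw [Finset.card_insert_of_notMem ha]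
    by_cases haD : a ∈ D
    · have h1 : ∑ T ∈ U.powerset, (-1 : ℤ) ^ (U.card + 1 - T.card) * (if D ⊆ T then 1 else 0) = 0 := by
        apply Finset.sum_eq_zero
        intro T hT
        rw [if_neg (fun h => (hc T hT).2.2 (h haD)), mul_zero]
      have h2 : ∀ T, (D ⊆ insert a T ↔ D.erase a ⊆ T) := fun T => by
        rw [Finset.subset_insert_iff]
      rw [h1, zero_add]
      have h3 := ih (D.erase a)
      have h4 : (D = insert a U) ↔ (D.erase a = U) := by
        constructor
        · rintro rfl; exact Finset.erase_insert ha
        · rintro rfl; exact (Finset.insert_erase haD).symm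
      simp only [h4, h2]
      rw [← h3]
      apply Finset.sum_congr rfl
      intro T hT
      rw [(hc T hT).1, Nat.add_sub_add_right]
    · have h2 : ∀ T, (D ⊆ insert a T ↔ D ⊆ T) := fun T => by
        rw [Finset.subset_insert_iff, Finset.erase_eq_of_notMem haD]
      rw [if_neg (show D ≠ insert a U from fun h => haD (h ▸ Finset.mem_insert_self a U)), ← Finset.sum_add_distrib]
      apply Finset.sum_eq_zero
      intro T hT
      obtain ⟨h3, h4, h5⟩ := hc T hT
      simp only [h2]
      rw [h3, Nat.add_sub_add_right, show U.card + 1 - T.card = (U.card - T.card) + 1 by omega]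
      ring

lemma B_alt_descSub (m : ℕ) (U : Finset ℕ) :
    (∑ T ∈ U.powerset, (-1 : ℤ) ^ (U.card - T.card) * (descSub m T : ℤ)) = numDescentSet m U := by
  have h1 : ∀ T, (descSub m T : ℤ) = ∑ w : Equiv.Perm (Fin m), if descentSet w ⊆ T then 1 else 0 := by
    intro T
    unfold descSub
    rw [Nat.card_eq_fintype_card, Fintype.card_subtype]
    simp
  have h2 : (numDescentSet m U : ℤ) = ∑ w : Equiv.Perm (Fin m), if descentSet w = U then 1 else 0 := by
    unfold numDescentSet
    rw [Nat.card_eq_fintype_card, Fintype.card_subtype]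
    simp
  simp only [h1, h2, Finset.mul_sum]
  rw [Finset.sum_comm]
  exact Finset.sum_congr rfl fun w _ => B_alt U _

lemma B_descSub_congr (m : ℕ) (T T' : Finset ℕ) (h : ∀ i, 1 ≤ i → i < m → (i ∈ T ↔ i ∈ T')) :
    descSub m T = descSub m T' := by
  unfold descSub
  have : ∀ w : Equiv.Perm (Fin m), descentSet w ⊆ T ↔ descentSet w ⊆ T' := by
    intro w
    have hw : ∀ i ∈ descentSet w, 1 ≤ i ∧ i < m := by
      intro i hi
      obtain ⟨h1, h2, _⟩ := (A_mem_descentSet w i).1 hi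
      exact ⟨h1, h2⟩
    exact ⟨fun hs i hi => (h i (hw i hi).1 (hw i hi).2).1 (hs hi),
      fun hs i hi => (h i (hw i hi).1 (hw i hi).2).2 (hs hi)⟩
  simp only [this]

/-- group subsets by their maximum -/
lemma B_sum_powerset_max (G : Finset ℕ → ℤ) (S : Finset ℕ) :
    ∑ T ∈ S.powerset, G T = G ∅ + ∑ s ∈ S, ∑ T ∈ (S.filter (· < s)).powerset, G (insert s T) := by
  induction S using Finset.induction_on_max with
  | empty => simp
  | insert a S ha ih =>
    have hna : a ∉ S := fun h => lt_irrefl _ (ha a h)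
    rw [Finset.sum_powerset_insert hna, ih, Finset.sum_insert hna]
    have h1 : (insert a S).filter (· < a) = S := by
      ext x
      simp only [Finset.mem_filter, Finset.mem_insert]
      constructor
      · rintro ⟨rfl | h, h'⟩
        · omega
        · exact h
      · intro h; exact ⟨Or.inr h, ha x h⟩
    have h2 : ∀ s ∈ S, (insert a S).filter (· < s) = S.filter (· < s) := by
      intro s hs
      rw [Finset.filter_insert, if_neg (by have := ha s hs; omega)]
    have h3 : ∑ s ∈ S, ∑ T ∈ ((insert a S).filter (· < s)).powerset, G (insert s T) =
        ∑ s ∈ S, ∑ T ∈ (S.filter (· < s)).powerset, G (insert s T) :=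
      Finset.sum_congr rfl (fun s hs => by rw [h2 s hs])
    rw [h1, h3]
    ring

lemma B_sum_sElt (n : ℕ) (S : Finset ℕ) (G : ℕ → ℕ → ℤ) :
    ∑ s ∈ S, G (S.filter (· < s)).card s = ∑ j ∈ Finset.range S.card, G j (sElt n S (j + 1)) := by
  have h1 : ∀ j : Fin S.card, sElt n S (j + 1) = S.orderEmbOfFin rfl j := by
    intro j
    unfold sElt
    rw [if_neg (by omega), if_pos (by omega), Finset.orderEmbOfFin_apply]
    simp
  have h2 : ∀ j : Fin S.card, (S.filter (· < S.orderEmbOfFin rfl j)).card = j := by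
    intro j
    have : S.filter (· < S.orderEmbOfFin rfl j) =
        (Finset.univ.filter (fun i : Fin S.card => i < j)).map (S.orderEmbOfFin rfl).toEmbedding := by
      ext x
      simp only [Finset.mem_filter, Finset.mem_map, Finset.mem_univ, true_and]
      constructor
      · rintro ⟨hx, hlt⟩
        have : x ∈ Set.range (S.orderEmbOfFin rfl) := by rw [Finset.range_orderEmbOfFin]; exact hx
        obtain ⟨i, rfl⟩ := this
        exact ⟨i, by simpa using hlt, rfl⟩
      · rintro ⟨i, hi, rfl⟩
        exact ⟨Finset.orderEmbOfFin_mem _ _ _, by simpa using hi⟩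
    rw [this, Finset.card_map, ← Fin.card_Iio j]
    congr 1
    ext x
    simp only [Finset.mem_filter, Finset.mem_univ, true_and, Finset.mem_Iio]
  rw [Finset.sum_range]
  symm
  refine Finset.sum_bij (fun j _ => S.orderEmbOfFin rfl j) ?_ ?_ ?_ ?_
  · intro j _; exact Finset.orderEmbOfFin_mem _ _ _
  · intro i _ j _ h; exact (S.orderEmbOfFin rfl).injective h
  · intro x hx
    have : x ∈ Set.range (S.orderEmbOfFin rfl) := by rw [Finset.range_orderEmbOfFin]; exact hx
    obtain ⟨i, rfl⟩ := this
    exact ⟨i, Finset.mem_univ _, rfl⟩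
  · intro j _
    rw [h2, h1]

lemma B_main (n r : ℕ) (S : Finset ℕ) (F : ℕ → ℤ) :
    ∑ T ∈ S.powerset, (-1 : ℤ) ^ (S.card - T.card) *
      ((descSub (T.sup id) T : ℤ) * (r : ℤ) ^ (T.sup id) * F (T.sup id)) =
    (-1 : ℤ) ^ S.card * F 0 + ∑ j ∈ Finset.range S.card,
          (-1 : ℤ) ^ (S.card - 1 - j) *
            (numDescentSet (sElt n S (j + 1)) (S.filter (· < sElt n S (j + 1))) : ℤ) *
            (r : ℤ) ^ sElt n S (j + 1) * F (sElt n S (j + 1)) := by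
  rw [B_sum_powerset_max, ← B_sum_sElt n S (fun j s => (-1 : ℤ) ^ (S.card - 1 - j) *
            (numDescentSet s (S.filter (· < s)) : ℤ) * (r : ℤ) ^ s * F s)]
  congr 1
  · have : descSub 0 ∅ = 1 := by
      unfold descSub
      rw [Nat.card_eq_fintype_card, Fintype.card_eq_one_iff]
      refine ⟨⟨1, ?_⟩, ?_⟩
      · intro i hi
        obtain ⟨_, h, _⟩ := (A_mem_descentSet _ i).1 hi
        omega
      · intro w; apply Subtype.ext; ext i; exact i.elim0
    simp [this]
  · apply Finset.sum_congr rfl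
    intro s hs
    rw [← B_alt_descSub, Finset.mul_sum, Finset.sum_mul, Finset.sum_mul]
    apply Finset.sum_congr rfl
    intro T hT
    rw [Finset.mem_powerset] at hT
    have hlt : ∀ x ∈ T, x < s := fun x hx => (Finset.mem_filter.1 (hT hx)).2
    have hsT : s ∉ T := fun h => lt_irrefl _ (hlt s h)
    have hsup : (insert s T).sup id = s := by
      rw [Finset.sup_insert]
      apply sup_eq_left.2
      apply Finset.sup_le
      intro x hx
      exact (hlt x hx).le
    have hd : descSub s (insert s T) = descSub s T := by
      apply B_descSub_congr
      intro i _ hi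
      simp [hi.ne]
    rw [hsup, hd, Finset.card_insert_of_notMem hsT]
    have hc1 := Finset.card_le_card hT
    have hc2 : (S.filter (· < s)).card < S.card := by
      apply Finset.card_lt_card
      rw [Finset.ssubset_iff_of_subset (Finset.filter_subset _ _)]
      exact ⟨s, hs, by simp⟩
    have : S.card - (T.card + 1) =
      (S.card - 1 - (S.filter (· < s)).card) + ((S.filter (· < s)).card - T.card) := by omega
    rw [this, pow_add]
    ring


/-! ### Part C: maximal chains of rank selected subposets -/

lemma C_interp {α : Type*} {u v : List α} (h : u.Sublist v) : ∀ s, u.length ≤ s → s ≤ v.length →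
    ∃ x : List α, u.Sublist x ∧ x.Sublist v ∧ x.length = s := by
  induction h with
  | slnil => intro s h1 h2; exact ⟨[], by simp, by simp, by simp at h2; simp [h2]⟩
  | @cons u v a h ih =>
    intro s h1 h2
    rcases Nat.lt_or_ge v.length s with h3 | h3
    · exact ⟨a :: v, h.cons a, List.Sublist.refl _, by simp at h2 ⊢; omega⟩
    · obtain ⟨x, hx1, hx2, hx3⟩ := ih s h1 h3
      exact ⟨x, hx1, hx2.cons a, hx3⟩
  | @cons_cons u v a h ih =>
    intro s h1 h2
    simp at h1 h2
    obtain ⟨x, hx1, hx2, hx3⟩ := ih (s - 1) (by omega) (by omega)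
    exact ⟨a :: x, hx1.cons_cons a, hx2.cons_cons a, by simp; omega⟩

lemma C_le_iff {n r : ℕ} (u v : CInjWord n r) : u ≤ v ↔ u.1.Sublist v.1 := Iff.rfl

lemma C_eq_of_le {n r : ℕ} {u v : CInjWord n r} (h : u ≤ v) (hl : v.1.length ≤ u.1.length) :
    u = v := Subtype.ext (List.Sublist.eq_of_length_le h hl)

lemma C_interp_word {n r : ℕ} {u v : CInjWord n r} (h : u ≤ v) (s : ℕ) (h1 : u.1.length ≤ s)
    (h2 : s ≤ v.1.length) : ∃ x : CInjWord n r, u ≤ x ∧ x ≤ v ∧ x.1.length = s := by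
  obtain ⟨x, hx1, hx2, hx3⟩ := C_interp h s h1 h2
  exact ⟨⟨x, (hx2.map Prod.fst).nodup v.2⟩, hx1, hx2, hx3⟩

lemma C_extend {n r : ℕ} (u : CInjWord n r) :
    ∃ v : CInjWord n r, u ≤ v ∧ v.1.length = n := by
  set rest := (List.finRange n).filter (fun i => i ∉ u.1.map Prod.fst) with hrest
  have hnd : ((u.1 ++ rest.map (fun i => (i, (0 : ZMod r)))).map Prod.fst).Nodup := by
    rw [List.map_append, List.map_map, List.nodup_append]
    refine ⟨u.2, ?_, ?_⟩
    · have : (Prod.fst ∘ fun i : Fin n => (i, (0 : ZMod r))) = id := rfl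
      rw [this, List.map_id]
      exact (List.nodup_finRange n).filter _
    · intro a ha b hb
      have : (Prod.fst ∘ fun i : Fin n => (i, (0 : ZMod r))) = id := rfl
      rw [this, List.map_id, hrest, List.mem_filter] at hb
      rintro rfl
      simpa using (of_decide_eq_true hb.2) ha
  refine ⟨⟨_, hnd⟩, List.sublist_append_left _ _, ?_⟩
  have h1 : ((u.1 ++ rest.map (fun i => (i, (0 : ZMod r)))).map Prod.fst).toFinset = Finset.univ := by
    ext a
    simp only [List.mem_toFinset, Finset.mem_univ, iff_true, List.map_append, List.mem_append,
      List.map_map]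
    by_cases h : a ∈ u.1.map Prod.fst
    · exact Or.inl h
    · right
      have : (Prod.fst ∘ fun i : Fin n => (i, (0 : ZMod r))) = id := rfl
      rw [this, List.map_id, hrest, List.mem_filter]
      exact ⟨List.mem_finRange a, decide_eq_true h⟩
  have h2 := List.toFinset_card_of_nodup hnd
  rw [h1, Finset.card_univ, Fintype.card_fin, List.length_map] at h2
  exact h2.symm

lemma C_mem_rankSel {n r : ℕ} {T : Finset ℕ} (u : CInjWord n r) :
    (u : WithTop (CInjWord n r)) ∈ rankSel (rkC n r) T ↔ u.1.length ∈ insert 0 T := by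
  unfold rankSel
  have hrk : rkC n r (u : WithTop (CInjWord n r)) = u.1.length := rfl
  simp only [Set.mem_union, Set.mem_ofPred_eq, hrk, Set.mem_insert_iff, Set.mem_singleton_iff,
    WithTop.coe_ne_top, or_false, Finset.mem_insert]
  have : ((u : WithTop (CInjWord n r)) = ⊥) ↔ u.1.length = 0 := by
    rw [← WithTop.coe_bot, WithTop.coe_inj]
    constructor
    · rintro rfl; rfl
    · intro h; exact (C_eq_of_le (bot_le : ⊥ ≤ u) (by rw [h]; omega)).symm
  rw [this]
  tauto

lemma C_top_mem {n r : ℕ} {T : Finset ℕ} : (⊤ : WithTop (CInjWord n r)) ∈ rankSel (rkC n r) T := by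
  unfold rankSel; simp

/-- flags of words -/
def CFlag (n r : ℕ) (T : Finset ℕ) (g : Equiv.Perm (Fin n)) : Type :=
  {x : (insert 0 T : Finset ℕ) → CInjWord n r //
    Monotone x ∧ (∀ s, (x s).1.length = s) ∧ ∀ s, permCWord g (x s) = x s}

/-- chain of a flag -/
def cflagSet {n r : ℕ} {T : Finset ℕ} (x : (insert 0 T : Finset ℕ) → CInjWord n r) :
    Set (WithTop (CInjWord n r)) :=
  insert ⊤ (Set.range fun s => ((x s : CInjWord n r) : WithTop (CInjWord n r)))

lemma C_comparable {n r : ℕ} {C : Set (WithTop (CInjWord n r))} (hC : IsChain (· ≤ ·) C)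
    {u v : CInjWord n r} (hu : (u : WithTop (CInjWord n r)) ∈ C)
    (hv : (v : WithTop (CInjWord n r)) ∈ C) (hl : u.1.length ≤ v.1.length) : u ≤ v := by
  rcases hC.total hu hv with h | h
  · exact WithTop.coe_le_coe.1 h
  · exact (C_eq_of_le (WithTop.coe_le_coe.1 h) hl).ge

lemma C_flag_max {n r : ℕ} {T : Finset ℕ} (x : (insert 0 T : Finset ℕ) → CInjWord n r)
    (hm : Monotone x) (hl : ∀ s, (x s).1.length = s) :
    cflagSet x ∈ maxChainsIn (rankSel (rkC n r) T) := by
  refine ⟨?_, ?_, ?_⟩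
  · rintro y (rfl | ⟨s, rfl⟩)
    · exact C_top_mem
    · simp only
      rw [C_mem_rankSel, hl]
      exact s.2
  · apply IsChain.insert
    · rintro _ ⟨s, rfl⟩ _ ⟨s', rfl⟩ _
      rcases le_total s s' with h | h
      · exact Or.inl (WithTop.coe_le_coe.2 (hm h))
      · exact Or.inr (WithTop.coe_le_coe.2 (hm h))
    · intro b _ _
      exact Or.inr le_top
  · intro D hD hch hsub
    apply Set.Subset.antisymm hsub
    intro d hd
    induction d using WithTop.recTopCoe with
    | top => exact Or.inl rfl
    | coe u =>
      right
      have h1 := (C_mem_rankSel u).1 (hD hd)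
      refine ⟨⟨u.1.length, h1⟩, ?_⟩
      have h2 : ((x ⟨u.1.length, h1⟩ : CInjWord n r) : WithTop (CInjWord n r)) ∈ D :=
        hsub (Or.inr ⟨_, rfl⟩)
      have h3 := C_comparable hch h2 hd (by rw [hl])
      simp only
      rw [C_eq_of_le h3 (by rw [hl])]

lemma C_hit {n r : ℕ} {T : Finset ℕ} (C : Set (WithTop (CInjWord n r)))
    (hC : C ∈ maxChainsIn (rankSel (rkC n r) T)) (hT : ∀ s ∈ T, s ≤ n) (s : ℕ)
    (hs : s ∈ insert 0 T) : ∃ u : CInjWord n r, (u : WithTop (CInjWord n r)) ∈ C ∧ u.1.length = s := by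
  obtain ⟨h1, h2, h3⟩ := hC
  have hsn : s ≤ n := by
    rcases Finset.mem_insert.1 hs with rfl | h
    · omega
    · exact hT s h
  have hadd : ∀ y ∈ rankSel (rkC n r) T, (∀ b ∈ C, y ≠ b → y ≤ b ∨ b ≤ y) → y ∈ C := by
    intro y hy hb
    rw [h3 (insert y C) (Set.insert_subset hy h1) (h2.insert hb) (Set.subset_insert _ _)]
    exact Set.mem_insert _ _
  have hbot : ((⊥ : CInjWord n r) : WithTop (CInjWord n r)) ∈ C := by
    apply hadd
    · rw [C_mem_rankSel]
      exact Finset.mem_insert_self _ _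
    · intro b _ _
      left
      exact bot_le
  set P : ℕ → Prop := fun l => ∃ u : CInjWord n r, (u : WithTop (CInjWord n r)) ∈ C ∧ u.1.length = l with hP
  have hP0 : P 0 := ⟨⊥, hbot, rfl⟩
  obtain ⟨u, huC, hul⟩ := Nat.findGreatest_spec (P := P) (Nat.zero_le s) hP0
  have hule : u.1.length ≤ s := hul ▸ Nat.findGreatest_le s
  have hlow : ∀ y : CInjWord n r, (y : WithTop (CInjWord n r)) ∈ C → y.1.length ≤ s → y ≤ u := by
    intro y hy hys
    apply C_comparable h2 hy huC
    rw [hul]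
    exact Nat.le_findGreatest hys ⟨y, hy, rfl⟩
  have hup : ∃ v : CInjWord n r, u ≤ v ∧ s ≤ v.1.length ∧
      ∀ y : CInjWord n r, (y : WithTop (CInjWord n r)) ∈ C → s ≤ y.1.length → v ≤ y := by
    by_cases hex : ∃ l, s ≤ l ∧ P l
    · obtain ⟨hle, v, hvC, hvl⟩ := Nat.find_spec hex
      refine ⟨v, C_comparable h2 huC hvC (by omega), by omega, ?_⟩
      intro y hy hys
      apply C_comparable h2 hvC hy
      rw [hvl]
      exact Nat.find_min' hex ⟨hys, y, hy, rfl⟩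
    · obtain ⟨v, hv1, hv2⟩ := C_extend u
      refine ⟨v, hv1, by omega, ?_⟩
      intro y hy hys
      exact absurd ⟨_, hys, y, hy, rfl⟩ hex
  obtain ⟨v, huv, hsv, hvy⟩ := hup
  obtain ⟨x, hx1, hx2, hx3⟩ := C_interp_word huv s hule hsv
  refine ⟨x, ?_, hx3⟩
  apply hadd
  · rw [C_mem_rankSel, hx3]
    exact hs
  · intro b hb _
    induction b using WithTop.recTopCoe with
    | top => exact Or.inl le_top
    | coe y =>
      rcases le_total y.1.length s with h | h
      · exact Or.inr (WithTop.coe_le_coe.2 ((hlow y hb h).trans hx1))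
      · exact Or.inl (WithTop.coe_le_coe.2 (hx2.trans (hvy y hb h)))

lemma C_alpha_eq_flag {n r : ℕ} {T : Finset ℕ} (hT : ∀ s ∈ T, s ≤ n) (g : Equiv.Perm (Fin n)) :
    cAlpha n r T g = (Nat.card (CFlag n r T g) : ℤ) := by
  unfold cAlpha gAlpha
  rw [← Nat.card_coe_set_eq]
  congr 1
  symm
  apply Nat.card_congr
  refine Equiv.ofBijective (fun x => ⟨cflagSet x.1, C_flag_max x.1 x.2.1 x.2.2.1, ?_⟩) ⟨?_, ?_⟩
  · unfold cflagSet
    rw [Set.image_insert_eq, ← Set.range_comp]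
    congr 1
    congr 1
    funext s
    simp only [Function.comp, WithTop.map_coe]
    rw [x.2.2.2 s]
  · rintro ⟨x, hx1, hx2, hx3⟩ ⟨y, hy1, hy2, hy3⟩ hxy
    have h := congrArg Subtype.val hxy
    simp only at h
    apply Subtype.ext
    simp only
    funext s
    have h1 : ((x s : CInjWord n r) : WithTop (CInjWord n r)) ∈ cflagSet y := by
      rw [← h]; exact Or.inr ⟨s, rfl⟩
    have h2 : ((y s : CInjWord n r) : WithTop (CInjWord n r)) ∈ cflagSet y := Or.inr ⟨s, rfl⟩
    have h3 := C_comparable (C_flag_max y hy1 hy2).2.1 h1 h2 (by rw [hx2, hy2])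
    exact C_eq_of_le h3 (by rw [hx2, hy2])
  · rintro ⟨C, hC, hfix⟩
    have hhit := C_hit C hC hT
    choose x hxC hxl using fun s : (insert 0 T : Finset ℕ) => hhit s s.2
    have hmono : Monotone x := by
      intro s s' hss
      exact C_comparable hC.2.1 (hxC s) (hxC s') (by rw [hxl, hxl]; exact hss)
    refine ⟨⟨x, hmono, hxl, ?_⟩, ?_⟩
    · intro s
      have h1 : ((permCWord g (x s) : CInjWord n r) : WithTop (CInjWord n r)) ∈ C := by
        rw [← hfix]
        exact ⟨_, hxC s, rfl⟩
      have hlen : (permCWord g (x s)).1.length = (x s).1.length := by simp [permCWord]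
      exact C_eq_of_le (C_comparable hC.2.1 h1 (hxC s) hlen.le) hlen.ge
    · apply Subtype.ext
      simp only
      apply (C_flag_max x hmono hxl).2.2 C hC.1 hC.2.1
      rintro y (rfl | ⟨s, rfl⟩)
      · rw [hC.2.2 (insert ⊤ C) (Set.insert_subset C_top_mem hC.1)
          (hC.2.1.insert (fun b _ _ => Or.inr le_top)) (Set.subset_insert _ _)]
        exact Set.mem_insert _ _
      · exact hxC s


/-! ### Part E: counting flags of words -/

/-- number of `g`-fixed injections -/
noncomputable def fixE (n t : ℕ) (g : Equiv.Perm (Fin n)) : ℕ :=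
  Nat.card {u : Fin t ↪ Fin n // ∀ i, g (u i) = u i}

lemma E_filter_of_sublist {α : Type*} {l' l : List α} (h : l'.Sublist l) (hl : l.Nodup) :
    l.filter (fun a => decide (a ∈ l')) = l' := by
  induction h with
  | slnil => rfl
  | @cons u v a h ih =>
    rw [List.nodup_cons] at hl
    rw [List.filter_cons_of_neg, ih hl.2]
    simpa using fun ha => hl.1 (h.subset ha)
  | @cons_cons u v a h ih =>
    rw [List.nodup_cons] at hl
    rw [List.filter_cons_of_pos (by simp)]
    congr 1
    refine Eq.trans ?_ (ih hl.2)
    apply List.filter_congr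
    intro x hx
    have : x ≠ a := by rintro rfl; exact hl.1 hx
    simp [this]

/-- the subword at positions `A` -/
def subList {n r t : ℕ} (e : Fin t → Fin n) (c : Fin t → ZMod r) (A : Finset (Fin t)) :
    List (Fin n × ZMod r) :=
  ((List.finRange t).filter (fun i => decide (i ∈ A))).map (fun i => (e i, c i))

lemma E_length {n r t : ℕ} (e : Fin t → Fin n) (c : Fin t → ZMod r) (A : Finset (Fin t)) :
    (subList e c A).length = A.card := by
  unfold subList
  rw [List.length_map]
  have hn : ((List.finRange t).filter (fun i => decide (i ∈ A))).Nodup :=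
    (List.nodup_finRange t).filter _
  rw [← List.toFinset_card_of_nodup hn]
  congr 1
  ext i
  simp

lemma E_nodup {n r t : ℕ} (e : Fin t ↪ Fin n) (c : Fin t → ZMod r) (A : Finset (Fin t)) :
    ((subList e c A).map Prod.fst).Nodup := by
  unfold subList
  rw [List.map_map]
  apply List.Nodup.map
  · exact e.injective
  · exact (List.nodup_finRange t).filter _

lemma E_mem {n r t : ℕ} (e : Fin t ↪ Fin n) (c : Fin t → ZMod r) (A : Finset (Fin t)) (i : Fin t) :
    (e i, c i) ∈ subList e c A ↔ i ∈ A := by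
  unfold subList
  simp only [List.mem_map, List.mem_filter, List.mem_finRange, true_and, decide_eq_true_eq,
    Prod.mk.injEq]
  constructor
  · rintro ⟨j, hj, h1, _⟩
    rwa [← e.injective h1]
  · intro h; exact ⟨i, h, rfl, rfl⟩

lemma E_mono {n r t : ℕ} (e : Fin t → Fin n) (c : Fin t → ZMod r) {A B : Finset (Fin t)}
    (h : A ⊆ B) : (subList e c A).Sublist (subList e c B) := by
  unfold subList
  apply List.Sublist.map
  apply List.monotone_filter_right
  intro i hi
  simp only [decide_eq_true_eq] at hi ⊢
  exact h hi

lemma E_card_flag (n r : ℕ) (T : Finset ℕ) (g : Equiv.Perm (Fin n)) :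
    Nat.card (CFlag n r T g) = fixE n (T.sup id) g * (Nat.card (Fin (T.sup id) → ZMod r) *
      descSub (T.sup id) (insert 0 T)) := by
  set t := T.sup id with ht
  have hle : ∀ s ∈ (insert 0 T : Finset ℕ), s ≤ t := by
    intro s hs
    rcases Finset.mem_insert.1 hs with rfl | h
    · omega
    · exact Finset.le_sup (f := id) h
  have htm : t ∈ (insert 0 T : Finset ℕ) := by
    rcases T.eq_empty_or_nonempty with h | h
    · subst h; simp [ht]
    · obtain ⟨a, ha, hat⟩ := Finset.exists_mem_eq_sup T h id
      rw [ht, hat]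
      exact Finset.mem_insert_of_mem ha
  rw [← card_chain_subsets t _ hle]
  unfold fixE
  rw [← Nat.card_prod, ← Nat.card_prod]
  symm
  apply Nat.card_congr
  refine Equiv.ofBijective (fun p => ⟨fun s => ⟨subList p.1.1 p.2.1 (p.2.2.1 s), E_nodup _ _ _⟩,
    ?_, ?_, ?_⟩) ⟨?_, ?_⟩
  · intro s s' hs
    exact E_mono _ _ (p.2.2.2.1 hs)
  · intro s
    exact (E_length _ _ _).trans (p.2.2.2.2 s)
  · intro s
    apply Subtype.ext
    simp only [permCWord]
    unfold subList
    rw [List.map_map]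
    apply List.map_congr_left
    intro i _
    simp [p.1.2 i]
  · rintro ⟨⟨e, he⟩, c, ⟨A, hA1, hA2⟩⟩ ⟨⟨e', he'⟩, c', ⟨A', hA1', hA2'⟩⟩ h
    have h0 : ∀ s, subList e c (A s) = subList e' c' (A' s) := by
      intro s
      have := congrArg (fun x : CFlag n r T g => (x.1 s).1) h
      exact this
    have hu : ∀ B : Finset (Fin t), B.card = t → B = Finset.univ := by
      intro B hB
      exact (Finset.card_eq_iff_eq_univ B).1 (by simpa using hB)
    have h1 := h0 ⟨t, htm⟩
    rw [hu (A ⟨t, htm⟩) (hA2 ⟨t, htm⟩), hu (A' ⟨t, htm⟩) (hA2' ⟨t, htm⟩)] at h1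
    unfold subList at h1
    simp only [Finset.mem_univ, decide_true, List.filter_true] at h1
    have h2 := List.map_inj_left.1 h1
    have h3 : e = e' := by
      ext i
      have := h2 i (List.mem_finRange i)
      simp only [Prod.mk.injEq] at this
      rw [this.1]
    have h4 : c = c' := by
      ext i
      have := h2 i (List.mem_finRange i)
      simp only [Prod.mk.injEq] at this
      rw [this.2]
    subst h3
    subst h4
    have h5 : A = A' := by
      funext s
      ext i
      rw [← E_mem e c, h0, E_mem]
    subst h5
    rfl
  · rintro ⟨x, hx1, hx2, hx3⟩
    set v := x ⟨t, htm⟩ with hv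
    have hvl : v.1.length = t := hx2 _
    have hvnd : v.1.Nodup := v.2.of_map _
    have hmapv : (List.finRange t).map (fun i : Fin t => v.1[i.1]'(by omega)) = v.1 := by
      apply List.ext_getElem
      · simp [hvl]
      · intro i h1 h2
        simp
    have heinj : Function.Injective (fun i : Fin t => (v.1[i.1]'(by omega)).1) := by
      intro i j hij
      have h1 : (v.1.map Prod.fst)[i.1]'(by simp; omega) = (v.1.map Prod.fst)[j.1]'(by simp; omega) := by
        simpa using hij
      exact Fin.ext ((List.Nodup.getElem_inj_iff v.2).1 h1)
    set e : Fin t ↪ Fin n := ⟨fun i : Fin t => (v.1[i.1]'(by omega)).1, heinj⟩ with he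
    set c : Fin t → ZMod r := fun i : Fin t => (v.1[i.1]'(by omega)).2 with hc
    have hec : (fun i : Fin t => (e i, c i)) = (fun i : Fin t => v.1[i.1]'(by omega)) := rfl
    set A : (insert 0 T : Finset ℕ) → Finset (Fin t) :=
      fun s => Finset.univ.filter fun i => (e i, c i) ∈ (x s).1 with hA
    have hsub : ∀ s, subList e c (A s) = (x s).1 := by
      intro s
      have hs : (x s).1.Sublist v.1 := hx1 (show s ≤ ⟨t, htm⟩ from hle s s.2)
      rw [← E_filter_of_sublist hs hvnd]
      unfold subList
      conv_rhs => rw [← hmapv, ← hec, List.filter_map]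
      congr 1
      apply List.filter_congr
      intro i _
      simp [hA]
    refine ⟨⟨⟨e, ?_⟩, c, ⟨A, ?_, ?_⟩⟩, ?_⟩
    · intro i
      have h1 := congrArg Subtype.val (hx3 ⟨t, htm⟩)
      simp only [permCWord] at h1
      rw [← hv] at h1
      have h2 : (v.1.map (fun p => (g p.1, p.2)))[i.1]'(by simp; omega) = v.1[i.1]'(by omega) := by
        simp only [h1]
      rw [List.getElem_map] at h2
      exact congrArg Prod.fst h2
    · intro s s' hs i hi
      simp only [hA, Finset.mem_filter, Finset.mem_univ, true_and] at hi ⊢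
      exact List.Sublist.subset (show (x s).1.Sublist (x s').1 from hx1 hs) hi
    · intro s
      rw [← E_length e c, hsub, hx2]
    · apply Subtype.ext
      funext s
      apply Subtype.ext
      exact hsub s

lemma E_alpha {n r : ℕ} {T : Finset ℕ} (hT : ∀ s ∈ T, s ≤ n) (g : Equiv.Perm (Fin n)) :
    cAlpha n r T g = (descSub (T.sup id) T : ℤ) * (r : ℤ) ^ (T.sup id) * (fixE n (T.sup id) g : ℤ) := by
  rw [C_alpha_eq_flag hT, E_card_flag, Nat.card_fun, Nat.card_zmod, Nat.card_fin]
  rw [B_descSub_congr _ (insert 0 T) T (by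
    intro i hi _
    rw [Finset.mem_insert]
    constructor
    · rintro (h | h)
      · omega
      · exact h
    · exact Or.inr)]
  push_cast
  ring


/-! ### Part F: Burnside -/

/-- words whose content is bounded by `c` -/
noncomputable def wcount (t k : ℕ) (c : Fin k → ℤ) : ℕ :=
  Nat.card {w : Fin t → Fin k // ∀ i, ((Nat.card {x : Fin t // w x = i} : ℕ) : ℤ) ≤ c i}

/-- pairs of an injection and a function of given content -/
def FX (n t k : ℕ) (c : Fin k → ℤ) : Type :=
  {p : (Fin t ↪ Fin n) × (Fin n → Fin k) //
    ∀ i, ((Nat.card {x : Fin n // p.2 x = i} : ℕ) : ℤ) = c i}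

instance (n t k : ℕ) (c : Fin k → ℤ) : Finite (FX n t k c) := by unfold FX; infer_instance

instance (n t k : ℕ) (c : Fin k → ℤ) : MulAction (Equiv.Perm (Fin n)) (FX n t k c) where
  smul g p := ⟨(p.1.1.trans g.toEmbedding, p.1.2 ∘ g.symm), by
    intro i
    rw [← p.2 i]
    congr 1
    apply Nat.card_congr
    exact (Equiv.subtypeEquiv g.symm (fun x => Iff.rfl))⟩
  one_smul p := rfl
  mul_smul g h p := rfl

lemma F_smul_def {n t k : ℕ} {c : Fin k → ℤ} (g : Equiv.Perm (Fin n)) (p : FX n t k c) :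
    (g • p).1 = (p.1.1.trans g.toEmbedding, p.1.2 ∘ g.symm) := rfl

lemma F_exists_perm {α β : Type*} [Finite α] (F G : α → β)
    (h : ∀ b, Nat.card {a // F a = b} = Nat.card {a // G a = b}) :
    ∃ g : Equiv.Perm α, ∀ a, G (g a) = F a := by
  have e : ∀ b, {a // F a = b} ≃ {a // G a = b} := fun b => Classical.choice (Finite.card_eq.1 (h b))
  refine ⟨(Equiv.sigmaFiberEquiv F).symm.trans ((Equiv.sigmaCongrRight e).trans (Equiv.sigmaFiberEquiv G)), ?_⟩
  intro a
  exact ((e (F a)) ⟨a, rfl⟩).2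

/-- combined labelling -/
noncomputable def FLab {n t k : ℕ} (u : Fin t ↪ Fin n) (f : Fin n → Fin k) (x : Fin n) : Fin t ⊕ Fin k :=
  if h : ∃ i, u i = x then Sum.inl h.choose else Sum.inr (f x)

lemma F_lab_inl {n t k : ℕ} (u : Fin t ↪ Fin n) (f : Fin n → Fin k) (x : Fin n) (i : Fin t) :
    FLab u f x = Sum.inl i ↔ x = u i := by
  unfold FLab
  split_ifs with h
  · rw [Sum.inl.injEq]
    constructor
    · intro h'; rw [← h', h.choose_spec]
    · intro h'; exact u.injective (by rw [h.choose_spec, h'])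
  · simp only [false_iff]
    rintro rfl
    exact h ⟨i, rfl⟩

lemma F_lab_inr {n t k : ℕ} (u : Fin t ↪ Fin n) (f : Fin n → Fin k) (x : Fin n) (j : Fin k) :
    FLab u f x = Sum.inr j ↔ f x = j ∧ ¬ ∃ i, u i = x := by
  unfold FLab
  split_ifs with h
  · simp [h]
  · simp [h]

lemma F_card_split {n t k : ℕ} (u : Fin t ↪ Fin n) (f : Fin n → Fin k) (j : Fin k) :
    Nat.card {x // f x = j} = Nat.card {x // FLab u f x = Sum.inr j} + Nat.card {i // f (u i) = j} := by
  have h1 : Nat.card {i // f (u i) = j} = Nat.card {x // f x = j ∧ ∃ i, u i = x} := by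
    apply Nat.card_congr
    refine Equiv.ofBijective (fun i => ⟨u i.1, i.2, i.1, rfl⟩) ⟨?_, ?_⟩
    · intro a b hab
      exact Subtype.ext (u.injective (congrArg Subtype.val hab))
    · rintro ⟨x, hx, i, rfl⟩
      exact ⟨⟨i, hx⟩, rfl⟩
  simp only [F_lab_inr]
  rw [h1]
  simp only [Nat.card_eq_fintype_card, Fintype.card_subtype]
  rw [add_comm, ← Finset.filter_filter, ← Finset.filter_filter]
  exact (Finset.card_filter_add_card_filter_not _).symm

lemma F_orbit {n t k : ℕ} {c : Fin k → ℤ} (p q : FX n t k c)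
    (h : p.1.2 ∘ p.1.1 = q.1.2 ∘ q.1.1) : ∃ g : Equiv.Perm (Fin n), g • p = q := by
  obtain ⟨g, hg⟩ := F_exists_perm (FLab p.1.1 p.1.2) (FLab q.1.1 q.1.2) (by
    intro b
    rcases b with i | j
    · simp only [F_lab_inl]
      simp
    · have h1 := F_card_split p.1.1 p.1.2 j
      have h2 := F_card_split q.1.1 q.1.2 j
      have h3 : Nat.card {i // p.1.2 (p.1.1 i) = j} = Nat.card {i // q.1.2 (q.1.1 i) = j} := by
        have : ∀ i, p.1.2 (p.1.1 i) = q.1.2 (q.1.1 i) := fun i => congrFun h i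
        simp only [this]
      have h4 : (Nat.card {x // p.1.2 x = j} : ℤ) = Nat.card {x // q.1.2 x = j} := by
        rw [p.2, q.2]
      have h5 : Nat.card {x // p.1.2 x = j} = Nat.card {x // q.1.2 x = j} := by exact_mod_cast h4
      omega)
  have hu : ∀ i, g (p.1.1 i) = q.1.1 i := by
    intro i
    rw [← F_lab_inl q.1.1 q.1.2, hg, F_lab_inl]
  have hf : ∀ x, q.1.2 (g x) = p.1.2 x := by
    intro x
    by_cases hx : ∃ i, p.1.1 i = x
    · obtain ⟨i, rfl⟩ := hx
      rw [hu]
      exact (congrFun h i).symm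
    · have h1 : FLab p.1.1 p.1.2 x = Sum.inr (p.1.2 x) := (F_lab_inr _ _ _ _).2 ⟨rfl, hx⟩
      rw [← hg, F_lab_inr] at h1
      exact h1.1
  refine ⟨g, Subtype.ext (Prod.ext ?_ ?_)⟩
  · ext i
    simp [F_smul_def, hu]
  · funext x
    simp [F_smul_def, ← hf]

lemma F_surj {n t k : ℕ} {c : Fin k → ℤ} (hc : ∑ i, c i = n) (w : Fin t → Fin k)
    (hw : ∀ i, ((Nat.card {x : Fin t // w x = i} : ℕ) : ℤ) ≤ c i) :
    ∃ p : FX n t k c, p.1.2 ∘ p.1.1 = w := by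
  have hc0 : ∀ i, ((c i).toNat : ℤ) = c i := fun i => Int.toNat_of_nonneg ((Int.natCast_nonneg _).trans (hw i))
  have hcard : Fintype.card (Fin n) = Fintype.card (Σ j : Fin k, Fin (c j).toNat) := by
    rw [Fintype.card_sigma]
    simp only [Fintype.card_fin]
    zify
    rw [← hc]
    exact Finset.sum_congr rfl fun i _ => (hc0 i).symm
  let e := Fintype.equivOfCardEq hcard
  have hemb : ∀ j, Nonempty ({x : Fin t // w x = j} ↪ Fin (c j).toNat) := by
    intro j
    apply Function.Embedding.nonempty_of_card_le
    rw [← Nat.card_eq_fintype_card, Fintype.card_fin]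
    zify
    rw [hc0]
    exact hw j
  let em := fun j => Classical.choice (hemb j)
  refine ⟨⟨(⟨fun i => e.symm ⟨w i, em (w i) ⟨i, rfl⟩⟩, ?_⟩, fun x => (e x).1), ?_⟩, ?_⟩
  · intro i i' hii
    have h1 := e.symm.injective hii
    have key : ∀ j j' (a : {x : Fin t // w x = j}) (b : {x : Fin t // w x = j'}),
        (⟨j, em j a⟩ : Σ j : Fin k, Fin (c j).toNat) = ⟨j', em j' b⟩ → a.1 = b.1 := by
      intro j j' a b hab
      obtain ⟨rfl, h⟩ := Sigma.mk.inj_iff.1 hab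
      rw [(em j).injective (eq_of_heq h)]
    exact key _ _ _ _ h1
  · intro j
    simp only
    rw [← hc0 j]
    congr 1
    rw [← Nat.card_fin (c j).toNat]
    apply Nat.card_congr
    exact (Equiv.subtypeEquiv (q := fun y => y.1 = j) e (fun x => Iff.rfl)).trans (Equiv.sigmaSubtype j)
  · funext i
    exact congrArg Sigma.fst (e.apply_symm_apply _)

lemma F_burnside (n t k : ℕ) (c : Fin k → ℤ) (hc : ∑ i, c i = n) :
    ∑ g : Equiv.Perm (Fin n), fixE n t g * fixedYoungFns n k c g⁻¹ = wcount t k c * n.factorial := by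
  have : Fintype (FX n t k c) := Fintype.ofFinite _
  have hB := MulAction.sum_card_fixedBy_eq_card_orbits_mul_card_group (Equiv.Perm (Fin n)) (FX n t k c)
  rw [Fintype.card_perm, Fintype.card_fin] at hB
  have h1 : wcount t k c = Fintype.card (Quotient (MulAction.orbitRel (Equiv.Perm (Fin n)) (FX n t k c))) := by
    rw [← Nat.card_eq_fintype_card]
    unfold wcount
    symm
    apply Nat.card_congr
    refine Equiv.ofBijective (Quotient.lift (fun p => ⟨p.1.2 ∘ p.1.1, ?_⟩) ?_) ⟨?_, ?_⟩
    · intro j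
      rw [← p.2 j, F_card_split p.1.1 p.1.2 j]
      simp
    · intro p q hpq
      obtain ⟨g, rfl⟩ := (MulAction.orbitRel_apply.1 hpq)
      apply Subtype.ext
      funext i
      simp [F_smul_def]
    · intro a b
      induction a using Quotient.inductionOn with | _ p
      induction b using Quotient.inductionOn with | _ q
      intro h
      simp only [Quotient.lift_mk, Subtype.mk.injEq] at h
      apply Quotient.sound
      obtain ⟨g, hg⟩ := F_orbit q p h.symm
      exact MulAction.orbitRel_apply.2 ⟨g, hg⟩
    · rintro ⟨w, hw⟩
      obtain ⟨p, hp⟩ := F_surj hc w hw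
      exact ⟨Quotient.mk _ p, Subtype.ext hp⟩
  rw [h1, ← hB]
  apply Finset.sum_congr rfl
  intro g _
  unfold fixE fixedYoungFns
  rw [← Nat.card_prod, ← Nat.card_eq_fintype_card]
  apply Nat.card_congr
  refine ⟨fun q => ⟨⟨(q.1.1, q.2.1), q.2.2.2⟩, ?_⟩, fun p => ⟨⟨p.1.1.1, ?_⟩, ⟨p.1.1.2, ?_, p.1.2⟩⟩, ?_, ?_⟩
  · refine MulAction.mem_fixedBy.2 (Subtype.ext (Prod.ext ?_ ?_))
    · ext i
      exact congrArg Fin.val (q.1.2 i)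
    · funext x
      exact q.2.2.1 x
  · intro i
    have := congrArg (fun z : FX n t k c => z.1.1 i) (MulAction.mem_fixedBy.1 p.2)
    simpa [F_smul_def] using this
  · intro x
    have := congrArg (fun z : FX n t k c => z.1.2 x) (MulAction.mem_fixedBy.1 p.2)
    exact this
  · intro q; rfl
  · intro p; rfl


/-! ### Part G: alternating word counts -/

/-- the Jacobi-Trudi alternating sum -/
noncomputable def altD (t k : ℕ) (l : Fin k → ℤ) : ℤ :=
  ∑ σ : Equiv.Perm (Fin k), ((Equiv.Perm.sign σ : ℤˣ) : ℤ) *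
    (wcount t k (fun i => l i + ((σ i : ℕ) : ℤ)) : ℤ)

lemma G_card_cons {t k : ℕ} (a : Fin k) (w : Fin t → Fin k) (i : Fin k) :
    Nat.card {x : Fin (t + 1) // (Fin.cons a w : Fin (t + 1) → Fin k) x = i} =
      (if i = a then 1 else 0) + Nat.card {x : Fin t // w x = i} := by
  simp only [Nat.card_eq_fintype_card, Fintype.card_subtype, Finset.card_filter]
  rw [Fin.sum_univ_succ]
  simp only [Fin.cons_zero, Fin.cons_succ, eq_comm]

lemma G_wcount_succ (t k : ℕ) (c : Fin k → ℤ) :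
    wcount (t + 1) k c = ∑ a, wcount t k (fun i => c i - if i = a then 1 else 0) := by
  unfold wcount
  rw [← Nat.card_sigma]
  symm
  apply Nat.card_congr
  refine Equiv.ofBijective (fun p => ⟨Fin.cons p.1 p.2.1, ?_⟩) ⟨?_, ?_⟩
  · intro i
    rw [G_card_cons]
    have : _ ≤ c i - (if i = p.1 then (1:ℤ) else 0) := p.2.2 i
    push_cast
    split_ifs at this ⊢ <;> linarith
  · rintro ⟨a, w, hw⟩ ⟨b, w', hw'⟩ h
    simp only [Subtype.mk.injEq] at h
    obtain ⟨rfl, rfl⟩ := Fin.cons_injective2 h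
    rfl
  · rintro ⟨w, hw⟩
    refine ⟨⟨w 0, Fin.tail w, ?_⟩, Subtype.ext (Fin.cons_self_tail w)⟩
    intro i
    have h1 := hw i
    rw [← Fin.cons_self_tail w, G_card_cons] at h1
    push_cast at h1
    simp only [Fin.cons_zero, Fin.tail_cons] at h1 ⊢
    split_ifs at h1 ⊢ <;> linarith

lemma G_succ (t k : ℕ) (l : Fin k → ℤ) :
    altD (t + 1) k l = ∑ a, altD t k (fun i => l i - if i = a then 1 else 0) := by
  unfold altD
  rw [Finset.sum_comm]
  apply Finset.sum_congr rfl
  intro σ _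
  rw [G_wcount_succ, Nat.cast_sum, Finset.mul_sum]
  apply Finset.sum_congr rfl
  intro a _
  have : (fun i => l i + ((σ i : ℕ) : ℤ) - if i = a then 1 else 0) =
      (fun i => (l i - if i = a then 1 else 0) + ((σ i : ℕ) : ℤ)) := by
    funext i; ring
  rw [this]

lemma G_wcount_perm (t k : ℕ) (c : Fin k → ℤ) (τ : Equiv.Perm (Fin k)) :
    wcount t k (c ∘ τ) = wcount t k c := by
  unfold wcount
  apply Nat.card_congr
  refine Equiv.subtypeEquiv (Equiv.arrowCongr (Equiv.refl _) τ) ?_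
  intro w
  have : ∀ i, Nat.card {x // (Equiv.arrowCongr (Equiv.refl (Fin t)) τ) w x = τ i} = Nat.card {x // w x = i} := by
    intro i
    simp
  constructor
  · intro h i
    have := this (τ.symm i)
    rw [Equiv.apply_symm_apply] at this
    rw [this]
    simpa using h (τ.symm i)
  · intro h i
    rw [← this]
    exact h (τ i)

lemma G_eq_zero_of_eq (t k : ℕ) (l : Fin k → ℤ) (a b : Fin k) (hab : a ≠ b) (h : l a = l b) :
    altD t k l = 0 := by
  have h1 : altD t k l = - altD t k l := by
    conv_lhs => unfold altD
    rw [← Equiv.sum_comp (Equiv.mulRight (Equiv.swap a b))]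
    unfold altD
    rw [← Finset.sum_neg_distrib]
    apply Finset.sum_congr rfl
    intro σ _
    rw [Equiv.coe_mulRight, Equiv.Perm.sign_mul, Equiv.Perm.sign_swap hab,
      ← G_wcount_perm t k (fun i => l i + ((σ i : ℕ) : ℤ)) (Equiv.swap a b)]
    have : (fun i => l i + (((σ * Equiv.swap a b) i : ℕ) : ℤ)) =
        (fun i => l i + ((σ i : ℕ) : ℤ)) ∘ (Equiv.swap a b) := by
      funext i
      simp only [Function.comp, Equiv.Perm.mul_apply]
      congr 1
      rcases eq_or_ne i a with rfl | hia
      · rw [Equiv.swap_apply_left, h]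
      · rcases eq_or_ne i b with rfl | hib
        · rw [Equiv.swap_apply_right, h]
        · rw [Equiv.swap_apply_of_ne_of_ne hia hib]
    rw [this]
    simp
  omega

lemma G_eq_zero_of_neg (t k : ℕ) (l : Fin k → ℤ) (a : Fin k) (h : l a + k ≤ 0) :
    altD t k l = 0 := by
  unfold altD
  apply Finset.sum_eq_zero
  intro σ _
  have : wcount t k (fun i => l i + ((σ i : ℕ) : ℤ)) = 0 := by
    unfold wcount
    rw [Nat.card_eq_zero]
    left
    refine ⟨fun w => ?_⟩
    have h1 : (Nat.card {x // w.1 x = a} : ℤ) ≤ l a + ((σ a : ℕ):ℤ) := w.2 a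
    have h2 := (σ a).2
    have h3 : (0 : ℤ) ≤ (Nat.card {x // w.1 x = a} : ℤ) := Int.natCast_nonneg _
    omega
  rw [this]
  simp

lemma G_zero (k : ℕ) (l : Fin k → ℤ) :
    altD 0 k l = Matrix.det (Matrix.of fun j i : Fin k => if 0 ≤ l i + ((j : ℕ) : ℤ) then (1 : ℤ) else 0) := by
  rw [Matrix.det_apply']
  unfold altD
  apply Finset.sum_congr rfl
  intro σ _
  congr 1
  simp only [Matrix.of_apply]
  rw [Finset.prod_boole]
  unfold wcount
  have h0 : ∀ (w : Fin 0 → Fin k) i, Nat.card {x : Fin 0 // w x = i} = 0 := by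
    intro w i; simp
  simp only [h0, Finset.mem_univ, true_implies, Nat.cast_zero]
  split_ifs with h
  · simp [h]
  · simp [h]

lemma G_base (μ : YoungDiagram) (k : ℕ) (hk : ∀ i, k ≤ i → μ.rowLen i = 0) :
    altD 0 k (fun i => (μ.rowLen i : ℤ) - ((i : ℕ) : ℤ)) = if (1, 0) ∈ μ then 0 else 1 := by
  rw [G_zero]
  split_ifs with h
  · rw [YoungDiagram.mem_iff_lt_rowLen] at h
    have hk1 : 1 < k := by
      by_contra hk1
      have := hk 1 (by omega)
      omega
    have h0 := μ.rowLen_anti 0 1 (by omega)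
    apply Matrix.det_zero_of_column_eq (i := ⟨0, by omega⟩) (j := ⟨1, hk1⟩)
    · simp
    · intro j
      simp only [Matrix.of_apply]
      rw [if_pos (by omega), if_pos (by push_cast; omega)]
  · rw [YoungDiagram.mem_iff_lt_rowLen] at h
    have h1 : ∀ i, 1 ≤ i → μ.rowLen i = 0 := by
      intro i hi
      have := μ.rowLen_anti 1 i hi
      omega
    rw [Matrix.det_of_lowerTriangular]
    · apply Finset.prod_eq_one
      intro i _
      simp
    · intro j i hij
      have hij' : j < i := hij
      have : (j : ℕ) < (i : ℕ) := hij'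
      simp only [Matrix.of_apply]
      rw [if_neg]
      rw [h1 i (by omega)]
      push_cast
      omega


/-! ### Part H: standard Young tableaux -/

lemma SYT_ext {μ : YoungDiagram} {Q Q' : SYT μ} (h : ∀ i j, Q.entry i j = Q'.entry i j) : Q = Q' := by
  have : Q.entry = Q'.entry := by funext i j; exact h i j
  cases Q
  cases Q'
  simp only at this
  subst this
  rfl

lemma SYT_pos {μ : YoungDiagram} (Q : SYT μ) {i j : ℕ} (h : (i, j) ∈ μ) :
    1 ≤ Q.entry i j ∧ Q.entry i j ≤ μ.card := by
  have := Q.bijOn.mapsTo (show (i, j) ∈ (↑μ.cells : Set (ℕ × ℕ)) from h)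
  simpa using this

lemma SYT_le {μ : YoungDiagram} (Q : SYT μ) (i j : ℕ) : Q.entry i j ≤ μ.card := by
  by_cases h : (i, j) ∈ μ
  · exact (SYT_pos Q h).2
  · rw [Q.entry_eq_zero i j h]; omega

lemma SYT_inj {μ : YoungDiagram} (Q : SYT μ) {p q : ℕ × ℕ} (hp : p ∈ μ) (hq : q ∈ μ)
    (h : Q.entry p.1 p.2 = Q.entry q.1 q.2) : p = q :=
  Q.bijOn.injOn (show p ∈ (↑μ.cells : Set (ℕ × ℕ)) from hp)
    (show q ∈ (↑μ.cells : Set (ℕ × ℕ)) from hq) h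

lemma SYT_surj {μ : YoungDiagram} (Q : SYT μ) {v : ℕ} (h1 : 1 ≤ v) (h2 : v ≤ μ.card) :
    ∃ p : ℕ × ℕ, p ∈ μ ∧ Q.entry p.1 p.2 = v := by
  obtain ⟨p, hp, he⟩ := Q.bijOn.surjOn (show v ∈ (↑(Finset.Icc 1 μ.card) : Set ℕ) by simp [h1, h2])
  exact ⟨p, hp, he⟩

instance (μ : YoungDiagram) : Finite (SYT μ) := by
  have : Function.Injective (fun (Q : SYT μ) (p : μ.cells) =>
      (⟨Q.entry p.1.1 p.1.2, Nat.lt_succ_of_le (SYT_le Q _ _)⟩ : Fin (μ.card + 1))) := by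
    intro Q Q' h
    apply SYT_ext
    intro i j
    by_cases hij : (i, j) ∈ μ
    · have := congrFun h ⟨(i, j), hij⟩
      simpa using this
    · rw [Q.entry_eq_zero i j hij, Q'.entry_eq_zero i j hij]
  exact Finite.of_injective _ this

/-- remove the last cell of row `a` -/
def remRow (μ : YoungDiagram) (a : ℕ) (h : μ.rowLen (a + 1) < μ.rowLen a) : YoungDiagram where
  cells := μ.cells.erase (a, μ.rowLen a - 1)
  isLowerSet := by
    rintro ⟨i, j⟩ ⟨i', j'⟩ hle hp
    obtain ⟨h1, h2⟩ := hle
    simp only at h1 h2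
    simp only [Finset.coe_erase, Set.mem_diff, Finset.mem_coe, YoungDiagram.mem_cells,
      Set.mem_singleton_iff, Prod.mk.injEq] at hp ⊢
    refine ⟨μ.up_left_mem h1 h2 hp.1, ?_⟩
    rintro ⟨rfl, rfl⟩
    have h3 := YoungDiagram.mem_iff_lt_rowLen.1 hp.1
    rcases Nat.lt_or_ge i' i with h4 | h4
    · have := μ.rowLen_anti (i' + 1) i (by omega)
      omega
    · have : i = i' := by omega
      subst this
      apply hp.2
      omega

lemma mem_remRow {μ : YoungDiagram} {a : ℕ} {h : μ.rowLen (a + 1) < μ.rowLen a} {p : ℕ × ℕ} :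
    p ∈ remRow μ a h ↔ p ∈ μ ∧ p ≠ (a, μ.rowLen a - 1) := by
  rw [← YoungDiagram.mem_cells]
  unfold remRow
  simp only [Finset.mem_erase, YoungDiagram.mem_cells]
  tauto

lemma corner_mem {μ : YoungDiagram} {a : ℕ} (h : μ.rowLen (a + 1) < μ.rowLen a) :
    (a, μ.rowLen a - 1) ∈ μ := by
  rw [YoungDiagram.mem_iff_lt_rowLen]; omega

lemma card_remRow {μ : YoungDiagram} {a : ℕ} (h : μ.rowLen (a + 1) < μ.rowLen a) :
    (remRow μ a h).card + 1 = μ.card :=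
  Finset.card_erase_add_one (corner_mem h)

lemma rowLen_remRow {μ : YoungDiagram} {a : ℕ} (h : μ.rowLen (a + 1) < μ.rowLen a) (i : ℕ) :
    (remRow μ a h).rowLen i = μ.rowLen i - if i = a then 1 else 0 := by
  apply eq_of_forall_lt_iff
  intro j
  rw [← YoungDiagram.mem_iff_lt_rowLen, mem_remRow, YoungDiagram.mem_iff_lt_rowLen]
  simp only [ne_eq, Prod.mk.injEq]
  split_ifs with hi
  · subst hi; simp; omega
  · simp [hi]

lemma corner_row {μ : YoungDiagram} {a : ℕ} (h : μ.rowLen (a + 1) < μ.rowLen a) {i j : ℕ}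
    (hij : (i, j) ∈ μ) (h1 : a ≤ i) (h2 : μ.rowLen a - 1 ≤ j) : (i, j) = (a, μ.rowLen a - 1) := by
  rw [YoungDiagram.mem_iff_lt_rowLen] at hij
  rcases Nat.lt_or_ge a i with h4 | h4
  · have := μ.rowLen_anti (a + 1) i (by omega)
    omega
  · have : i = a := by omega
    subst this
    rw [Prod.mk.injEq]
    omega

/-- add the maximal entry -/
def extSYT {μ : YoungDiagram} {a : ℕ} (h : μ.rowLen (a + 1) < μ.rowLen a) (Q : SYT (remRow μ a h)) :
    SYT μ where
  entry i j := if (i, j) = (a, μ.rowLen a - 1) then μ.card else Q.entry i j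
  entry_eq_zero i j hij := by
    rw [if_neg (by rintro hh; rw [hh] at hij; exact hij (corner_mem h))]
    apply Q.entry_eq_zero
    rw [mem_remRow]
    tauto
  row_strict i j1 j2 hj hm := by
    have hc := card_remRow h
    have hc1 : (i, j1) ≠ (a, μ.rowLen a - 1) := by
      intro hh
      have h1 : i = a := congrArg Prod.fst hh
      have h2 : j1 = μ.rowLen a - 1 := congrArg Prod.snd hh
      have := congrArg Prod.snd (corner_row h hm (by omega) (by omega))
      simp only at this
      omega
    rw [if_neg hc1]
    split_ifs with h2
    · have := SYT_le Q i j1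
      omega
    · exact Q.row_strict i j1 j2 hj (mem_remRow.2 ⟨hm, h2⟩)
  col_strict i1 i2 j hi hm := by
    have hc := card_remRow h
    have hc1 : (i1, j) ≠ (a, μ.rowLen a - 1) := by
      intro hh
      have h1 : i1 = a := congrArg Prod.fst hh
      have h2 : j = μ.rowLen a - 1 := congrArg Prod.snd hh
      have := congrArg Prod.fst (corner_row h hm (by omega) (by omega))
      simp only at this
      omega
    rw [if_neg hc1]
    split_ifs with h2
    · have := SYT_le Q i1 j
      omega
    · exact Q.col_strict i1 i2 j hi (mem_remRow.2 ⟨hm, h2⟩)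
  bijOn := by
    have hc := card_remRow h
    refine ⟨?_, ?_, ?_⟩
    · rintro ⟨i, j⟩ hp
      have hp' : (i, j) ∈ μ := hp
      simp only [Finset.coe_Icc, Set.mem_Icc]
      split_ifs with h2
      · omega
      · have := SYT_pos Q (mem_remRow.2 ⟨hp', h2⟩)
        omega
    · rintro ⟨i, j⟩ hp ⟨i', j'⟩ hq he
      have hp' : (i, j) ∈ μ := hp
      have hq' : (i', j') ∈ μ := hq
      simp only at he
      split_ifs at he with h1 h2 h2
      · rw [h1, h2]
      · have := SYT_le Q i' j'; omega
      · have := SYT_le Q i j; omega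
      · exact SYT_inj Q (mem_remRow.2 ⟨hp', h1⟩) (mem_remRow.2 ⟨hq', h2⟩) he
    · intro v hv
      simp only [Finset.coe_Icc, Set.mem_Icc] at hv
      rcases Nat.lt_or_ge v μ.card with h1 | h1
      · obtain ⟨p, hp, he⟩ := SYT_surj Q (v := v) hv.1 (by omega)
        rw [mem_remRow] at hp
        exact ⟨p, hp.1, by simp only; rw [if_neg hp.2, he]⟩
      · exact ⟨_, corner_mem h, by simp only [if_true]; omega⟩

/-- remove the maximal entry -/
def resSYT {μ : YoungDiagram} {a : ℕ} (h : μ.rowLen (a + 1) < μ.rowLen a) (Q : SYT μ)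
    (hQ : Q.entry a (μ.rowLen a - 1) = μ.card) : SYT (remRow μ a h) where
  entry i j := if (i, j) = (a, μ.rowLen a - 1) then 0 else Q.entry i j
  entry_eq_zero i j hij := by
    split_ifs with h1
    · rfl
    · apply Q.entry_eq_zero
      intro hm
      exact hij (mem_remRow.2 ⟨hm, h1⟩)
  row_strict i j1 j2 hj hm := by
    have hm2 := mem_remRow.1 ((remRow μ a h).up_left_mem le_rfl hj.le hm)
    have hm1 := mem_remRow.1 hm
    rw [if_neg hm1.2, if_neg hm2.2]
    exact Q.row_strict i j1 j2 hj hm1.1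
  col_strict i1 i2 j hi hm := by
    have hm2 := mem_remRow.1 ((remRow μ a h).up_left_mem hi.le le_rfl hm)
    have hm1 := mem_remRow.1 hm
    rw [if_neg hm1.2, if_neg hm2.2]
    exact Q.col_strict i1 i2 j hi hm1.1
  bijOn := by
    have hc := card_remRow h
    refine ⟨?_, ?_, ?_⟩
    · rintro ⟨i, j⟩ hp
      have hp' := mem_remRow.1 (show (i, j) ∈ remRow μ a h from hp)
      simp only [Finset.coe_Icc, Set.mem_Icc]
      rw [if_neg hp'.2]
      have h1 := SYT_pos Q hp'.1
      have h2 : Q.entry i j ≠ μ.card := by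
        intro he
        exact hp'.2 (SYT_inj Q (p := (i, j)) (q := (a, μ.rowLen a - 1)) hp'.1 (corner_mem h) (by rw [he, hQ]))
      omega
    · rintro ⟨i, j⟩ hp ⟨i', j'⟩ hq he
      have hp' := mem_remRow.1 (show (i, j) ∈ remRow μ a h from hp)
      have hq' := mem_remRow.1 (show (i', j') ∈ remRow μ a h from hq)
      simp only at he
      rw [if_neg hp'.2, if_neg hq'.2] at he
      exact SYT_inj Q hp'.1 hq'.1 he
    · intro v hv
      simp only [Finset.coe_Icc, Set.mem_Icc] at hv
      obtain ⟨p, hp, he⟩ := SYT_surj Q (v := v) hv.1 (by omega)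
      have hne : p ≠ (a, μ.rowLen a - 1) := by
        rintro rfl
        simp only at he
        omega
      exact ⟨p, mem_remRow.2 ⟨hp, hne⟩, by simp only; rw [if_neg hne, he]⟩

lemma H_rec (μ : YoungDiagram) (k m : ℕ) (hk : ∀ i, k ≤ i → μ.rowLen i = 0) (hm : m < μ.card) :
    fSYTRow μ m = ∑ a : Fin k,
      if h : μ.rowLen (a + 1) < μ.rowLen a then fSYTRow (remRow μ a h) m else 0 := by
  have h1 : (∑ a : Fin k,
      if h : μ.rowLen (a + 1) < μ.rowLen a then fSYTRow (remRow μ a h) m else 0) =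
      ∑ a : {a : Fin k // μ.rowLen (a + 1) < μ.rowLen a}, fSYTRow (remRow μ a.1 a.2) m := by
    have h2 := Finset.sum_subtype
      (Finset.univ.filter fun a : Fin k => μ.rowLen (a + 1) < μ.rowLen a)
      (p := fun a : Fin k => μ.rowLen (a + 1) < μ.rowLen a) (F := inferInstance) (by simp)
      (fun a => if h : μ.rowLen (a + 1) < μ.rowLen a then fSYTRow (remRow μ a h) m else 0)
    rw [Finset.sum_filter] at h2
    refine Eq.trans (Finset.sum_congr rfl fun a _ => ?_) (h2.trans (Finset.sum_congr rfl fun a _ => ?_))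
    · by_cases h : μ.rowLen (a + 1) < μ.rowLen a
      · rw [if_pos h]
      · rw [if_neg h, dif_neg h]
    · rw [dif_pos a.2]
  rw [h1]
  unfold fSYTRow
  rw [← Nat.card_sigma]
  symm
  apply Nat.card_congr
  refine Equiv.ofBijective (fun p => ⟨extSYT p.1.2 p.2.1, ?_⟩) ⟨?_, ?_⟩
  · intro v hv1 hv2
    obtain ⟨j, hj, he⟩ := p.2.2 v hv1 hv2
    rw [mem_remRow] at hj
    refine ⟨j, hj.1, ?_⟩
    simp only [extSYT]
    rw [if_neg hj.2, he]
  · rintro ⟨⟨a, ha⟩, Q, hQ⟩ ⟨⟨b, hb⟩, Q', hQ'⟩ h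
    have h2 := congrArg Subtype.val h
    simp only at h2
    have h3 : (extSYT ha Q).entry a (μ.rowLen a - 1) = μ.card := by simp [extSYT]
    have h4 : (extSYT hb Q').entry b (μ.rowLen b - 1) = μ.card := by simp [extSYT]
    have h5 : a = b := by
      rw [← h2] at h4
      have := SYT_inj (extSYT ha Q) (p := (a, μ.rowLen a - 1)) (q := (b, μ.rowLen b - 1))
        (corner_mem ha) (corner_mem hb) (by rw [h3, h4])
      exact Fin.ext (congrArg Prod.fst this)
    subst h5
    have h6 : Q = Q' := by
      apply SYT_ext
      intro i j
      by_cases hij : (i, j) = (↑a, μ.rowLen a - 1)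
      · have : (i, j) ∉ remRow μ a ha := fun hh => (mem_remRow.1 hh).2 hij
        rw [Q.entry_eq_zero i j this, Q'.entry_eq_zero i j this]
      · have := congrArg (fun Z : SYT μ => Z.entry i j) h2
        simp only [extSYT] at this
        rwa [if_neg hij, if_neg hij] at this
    subst h6
    rfl
  · rintro ⟨Q, hQ⟩
    obtain ⟨⟨a, c⟩, hp, he⟩ := SYT_surj Q (v := μ.card) (by omega) le_rfl
    simp only at he
    have hlt := YoungDiagram.mem_iff_lt_rowLen.1 hp
    have hak : a < k := by
      by_contra hh
      have := hk a (by omega)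
      omega
    have hc : c = μ.rowLen a - 1 := by
      by_contra hh
      have hm2 : (a, c + 1) ∈ μ := by rw [YoungDiagram.mem_iff_lt_rowLen]; omega
      have h2 := Q.row_strict a c (c + 1) (by omega) hm2
      have h3 := SYT_le Q a (c + 1)
      omega
    have hrem : μ.rowLen (a + 1) < μ.rowLen a := by
      by_contra hh
      have hm2 : (a + 1, c) ∈ μ := by rw [YoungDiagram.mem_iff_lt_rowLen]; omega
      have h2 := Q.col_strict a (a + 1) c (by omega) hm2
      have h3 := SYT_le Q (a + 1) c
      omega
    rw [hc] at he
    refine ⟨⟨⟨⟨a, hak⟩, hrem⟩, resSYT hrem Q he, ?_⟩, ?_⟩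
    · intro v hv1 hv2
      obtain ⟨j, hj, hej⟩ := hQ v hv1 hv2
      have hne : (0, j) ≠ (a, μ.rowLen a - 1) := by
        intro hh
        rw [Prod.mk.injEq] at hh
        rw [← hh.2, ← hh.1] at he
        omega
      refine ⟨j, mem_remRow.2 ⟨hj, hne⟩, ?_⟩
      simp only [resSYT]
      rw [if_neg hne, hej]
    · apply Subtype.ext
      apply SYT_ext
      intro i j
      simp only [extSYT, resSYT]
      split_ifs with h2
      · rw [Prod.mk.injEq] at h2
        rw [h2.1, h2.2, he]
      · rfl

lemma H_base (μ : YoungDiagram) : fSYTRow μ μ.card = if (1, 0) ∈ μ then 0 else 1 := by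
  unfold fSYTRow
  split_ifs with h
  · rw [Nat.card_eq_zero]
    left
    refine ⟨fun ⟨Q, hQ⟩ => ?_⟩
    have h1 := SYT_pos Q h
    obtain ⟨j, hj, he⟩ := hQ _ h1.1 h1.2
    have := SYT_inj Q (p := (0, j)) (q := (1, 0)) hj h he
    simp at this
  · have hrow : ∀ i j, (i, j) ∈ μ ↔ i = 0 ∧ j < μ.rowLen 0 := by
      intro i j
      constructor
      · intro hm
        have : i = 0 := by
          by_contra hi
          exact h (μ.up_left_mem (by omega) (by omega) hm)
        subst this
        exact ⟨rfl, YoungDiagram.mem_iff_lt_rowLen.1 hm⟩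
      · rintro ⟨rfl, hj⟩
        exact YoungDiagram.mem_iff_lt_rowLen.2 hj
    have hcard : μ.card = μ.rowLen 0 := by
      rw [YoungDiagram.rowLen_eq_card]
      unfold YoungDiagram.card
      congr 1
      ext ⟨i, j⟩
      rw [YoungDiagram.mem_row_iff, YoungDiagram.mem_cells]
      simp only [hrow]
      tauto
    have huniq : ∀ Q : SYT μ, ∀ j, j < μ.rowLen 0 → Q.entry 0 j = j + 1 := by
      intro Q j hj
      have hlow : ∀ j, j < μ.rowLen 0 → j + 1 ≤ Q.entry 0 j := by
        intro j
        induction j with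
        | zero => intro hj; exact (SYT_pos Q ((hrow 0 0).2 ⟨rfl, hj⟩)).1
        | succ j ih =>
          intro hj
          have h1 := ih (by omega)
          have h2 := Q.row_strict 0 j (j + 1) (by omega) ((hrow _ _).2 ⟨rfl, hj⟩)
          omega
      have hup : ∀ d j, j + d + 1 = μ.rowLen 0 → Q.entry 0 j ≤ j + 1 := by
        intro d
        induction d with
        | zero =>
          intro j hj
          have := SYT_le Q 0 j
          omega
        | succ d ih =>
          intro j hj
          have h1 := ih (j + 1) (by omega)
          have h2 := Q.row_strict 0 j (j + 1) (by omega) ((hrow _ _).2 ⟨rfl, by omega⟩)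
          omega
      have h1 := hlow j hj
      have h2 := hup (μ.rowLen 0 - 1 - j) j (by omega)
      omega
    rw [Nat.card_eq_one_iff_unique]
    refine ⟨⟨?_⟩, ?_⟩
    · rintro ⟨Q, _⟩ ⟨Q', _⟩
      apply Subtype.ext
      apply SYT_ext
      intro i j
      by_cases hij : (i, j) ∈ μ
      · obtain ⟨rfl, hj⟩ := (hrow _ _).1 hij
        simp only
        rw [huniq Q j hj, huniq Q' j hj]
      · rw [Q.entry_eq_zero i j hij, Q'.entry_eq_zero i j hij]
    · refine ⟨⟨⟨fun i j => if (i, j) ∈ μ then j + 1 else 0, ?_, ?_, ?_, ?_⟩, ?_⟩⟩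
      · intro i j hij
        rw [if_neg hij]
      · intro i j1 j2 hj hm
        rw [if_pos hm, if_pos (μ.up_left_mem le_rfl hj.le hm)]
        omega
      · intro i1 i2 j hi hm
        have := ((hrow _ _).1 hm).1
        omega
      · refine ⟨?_, ?_, ?_⟩
        · rintro ⟨i, j⟩ hp
          have hp' : (i, j) ∈ μ := hp
          have := (hrow _ _).1 hp'
          simp only [Finset.coe_Icc, Set.mem_Icc]
          rw [if_pos hp']
          omega
        · rintro ⟨i, j⟩ hp ⟨i', j'⟩ hq he
          have hp' : (i, j) ∈ μ := hp
          have hq' : (i', j') ∈ μ := hq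
          have h1 := (hrow _ _).1 hp'
          have h2 := (hrow _ _).1 hq'
          simp only at he
          rw [if_pos hp', if_pos hq'] at he
          rw [Prod.mk.injEq]
          omega
        · intro v hv
          simp only [Finset.coe_Icc, Set.mem_Icc] at hv
          have hm : (0, v - 1) ∈ μ := (hrow _ _).2 ⟨rfl, by omega⟩
          refine ⟨(0, v - 1), hm, ?_⟩
          simp only
          rw [if_pos hm]
          omega
      · intro v hv1 hv2
        have hm : (0, v - 1) ∈ μ := (hrow _ _).2 ⟨rfl, by omega⟩
        refine ⟨v - 1, hm, ?_⟩
        simp only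
        rw [if_pos hm]
        omega

lemma H_rowLen_card (μ : YoungDiagram) : μ.rowLen 0 = μ.card ↔ (1, 0) ∉ μ := by
  rw [YoungDiagram.rowLen_eq_card]
  unfold YoungDiagram.card
  have hsub : μ.row 0 ⊆ μ.cells := Finset.filter_subset _ _
  constructor
  · intro h hm
    have := Finset.eq_of_subset_of_card_le hsub h.ge
    have h2 : (1, 0) ∈ μ.row 0 := by rw [this]; exact hm
    simp [YoungDiagram.mem_row_iff] at h2
  · intro h
    congr 1
    apply Finset.Subset.antisymm hsub
    rintro ⟨i, j⟩ hm
    rw [YoungDiagram.mem_row_iff]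
    refine ⟨hm, ?_⟩
    by_contra hi
    simp only at hi
    exact h (μ.up_left_mem (by omega) (by omega) (show (i, j) ∈ μ from hm))

lemma H_main (t : ℕ) : ∀ (μ : YoungDiagram) (k : ℕ), (∀ i, k ≤ i → μ.rowLen i = 0) → t ≤ μ.card →
    altD t k (fun i => (μ.rowLen i : ℤ) - ((i : ℕ) : ℤ)) = fSYTRow μ (μ.card - t) := by
  induction t with
  | zero =>
    intro μ k hk _
    rw [G_base μ k hk, Nat.sub_zero, H_base]
    split_ifs <;> simp
  | succ t ih =>
    intro μ k hk ht
    rw [G_succ, H_rec μ k _ hk (by omega), Nat.cast_sum]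
    apply Finset.sum_congr rfl
    intro a _
    split_ifs with h
    · have hc := card_remRow h
      rw [show μ.card - (t + 1) = (remRow μ a h).card - t by omega, ← ih (remRow μ a h) k
        (by intro i hi; rw [rowLen_remRow, hk i hi]; omega) (by omega)]
      congr 1
      funext i
      rw [rowLen_remRow]
      by_cases hia : i = a
      · subst hia
        simp only [if_true]
        omega
      · have : (i : ℕ) ≠ a := fun hh => hia (Fin.ext hh)
        simp [hia, this]
    · have h0 := μ.rowLen_anti a (a + 1) (by omega)
      rcases Nat.lt_or_ge (a + 1) k with hak | hak
      · apply G_eq_zero_of_eq t k _ a ⟨a + 1, hak⟩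
        · intro hh
          have := congrArg Fin.val hh
          simp at this
        · have : (⟨a + 1, hak⟩ : Fin k) ≠ a := by
            intro hh
            have := congrArg Fin.val hh
            simp at this
          simp only [this, if_true, if_false]
          push_cast
          omega
      · apply G_eq_zero_of_neg t k _ a
        have := hk (a + 1) hak
        have := a.2
        simp only [if_true]
        omega


/-! ### Part I: assembly -/

lemma I_rows (μ : YoungDiagram) (i : ℕ) (hi : μ.rowLens.length ≤ i) : μ.rowLen i = 0 := by
  rw [YoungDiagram.length_rowLens] at hi
  by_contra h
  have h1 : (i, 0) ∈ μ := YoungDiagram.mem_iff_lt_rowLen.2 (by omega)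
  have := YoungDiagram.mem_iff_lt_colLen.1 h1
  omega

lemma I_sum (μ : YoungDiagram) : ∑ i : Fin μ.rowLens.length, μ.rowLen i = μ.card := by
  rw [Fin.sum_univ_eq_sum_range (fun i => μ.rowLen i)]
  unfold YoungDiagram.card
  rw [Finset.card_eq_sum_card_fiberwise (f := Prod.fst) (t := Finset.range μ.rowLens.length)]
  · apply Finset.sum_congr rfl
    intro i _
    rw [YoungDiagram.rowLen_eq_card]
    rfl
  · rintro ⟨i, j⟩ hp
    have hp' : (i, j) ∈ μ := hp
    have h1 := YoungDiagram.mem_iff_lt_rowLen.1 hp'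
    simp only [Finset.coe_range, Set.mem_Iio]
    by_contra h
    have := I_rows μ i (by omega)
    omega

lemma I_pair (n t : ℕ) (μ : YoungDiagram) (hμ : μ.card = n) (ht : t ≤ n) :
    ∑ g : Equiv.Perm (Fin n), (fixE n t g : ℤ) * chi n μ g⁻¹ =
      (fSYTRow μ (n - t) : ℤ) * (n.factorial : ℤ) := by
  subst hμ
  rw [← H_main t μ μ.rowLens.length (I_rows μ) ht]
  unfold chi altD
  simp only [Finset.mul_sum]
  rw [Finset.sum_comm, Finset.sum_mul]
  apply Finset.sum_congr rfl
  intro σ _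
  have hc : ∑ i : Fin μ.rowLens.length,
      (((μ.rowLen (i : ℕ) : ℕ) : ℤ) - ((i : ℕ) : ℤ) + ((σ i : ℕ) : ℤ)) = (μ.card : ℤ) := by
    rw [Finset.sum_add_distrib, Finset.sum_sub_distrib,
      Equiv.sum_comp σ (fun i : Fin μ.rowLens.length => ((i : ℕ) : ℤ)), ← I_sum μ]
    push_cast
    ring
  have h := F_burnside μ.card t μ.rowLens.length _ hc
  have h' := congrArg (Nat.cast : ℕ → ℤ) h
  push_cast at h'
  rw [mul_assoc, ← h', Finset.mul_sum]
  apply Finset.sum_congr rfl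
  intro g _
  ring

/-- **Eq. (15)**: for the `𝔖_n`-action on the poset of `r`-colored injective words and
`S = {s_1 < ⋯ < s_k} ⊆ {1,…,n-1}`, the multiplicity of `ρ^λ` in `β_P(S)` equals
`(-1)^k δ_{λ,(n)} + Σ_{i=1}^k (-1)^{k-i} b_{s_i}({s_1,…,s_{i-1}}) r^{s_i} f^{λ,n-s_i}`.
(The multiplicity `M` is characterized by `Σ_g φ(g) χ^λ(g⁻¹) = M * n!`; `δ_{λ,(n)} = 1`
precisely when the first row of `λ` has length `n`.) -/
theorem statement12 (n r : ℕ) (hn : 0 < n) (hr : 0 < r) (μ : YoungDiagram)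
    (hμ : μ.card = n) (S : Finset ℕ) (hS : S ⊆ Finset.Icc 1 (n - 1)) :
    (∑ g : Equiv.Perm (Fin n), cBeta n r S g * chi n μ g⁻¹) =
      ((-1 : ℤ) ^ S.card * (if μ.rowLen 0 = n then 1 else 0) +
        ∑ j ∈ Finset.range S.card,
          (-1 : ℤ) ^ (S.card - 1 - j) *
            (numDescentSet (sElt n S (j + 1)) (S.filter (· < sElt n S (j + 1))) : ℤ) *
            (r : ℤ) ^ sElt n S (j + 1) * (fSYTRow μ (n - sElt n S (j + 1)) : ℤ)) *
        (n.factorial : ℤ) := by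
  have hle : ∀ T ∈ S.powerset, ∀ s ∈ T, s ≤ n := by
    intro T hT s hs
    have := Finset.mem_Icc.1 (hS (Finset.mem_powerset.1 hT hs))
    omega
  have hB := B_main n r S (fun t => (fSYTRow μ (n - t) : ℤ))
  have h0 : (fSYTRow μ (n - 0) : ℤ) = if μ.rowLen 0 = n then 1 else 0 := by
    subst hμ
    rw [Nat.sub_zero, H_base]
    by_cases h : (1, 0) ∈ μ
    · rw [if_pos h, if_neg (fun hh => (H_rowLen_card μ).1 hh h)]
      rfl
    · rw [if_neg h, if_pos ((H_rowLen_card μ).2 h)]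
      rfl
  simp only [h0] at hB
  rw [← hB, Finset.sum_mul]
  have hb : ∀ g : Equiv.Perm (Fin n), cBeta n r S g =
      ∑ T ∈ S.powerset, (-1 : ℤ) ^ (S.card - T.card) * cAlpha n r T g := fun g => rfl
  simp only [hb, Finset.sum_mul]
  rw [Finset.sum_comm]
  apply Finset.sum_congr rfl
  intro T hT
  have hsup : T.sup id ≤ n := Finset.sup_le (fun s hs => hle T hT s hs)
  have hp := I_pair n (T.sup id) μ hμ hsup
  simp only [E_alpha (hle T hT)]
  rw [mul_assoc ((-1 : ℤ) ^ _), mul_assoc _ _ (n.factorial : ℤ), ← hp, Finset.mul_sum, Finset.mul_sum]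
  apply Finset.sum_congr rfl
  intro g _
  push_cast
  ring
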